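/- arXiv:1304.3830 — 2 statements merged into one kernel-verified Lean document; each statement's English description precedes it below -/
import Mathlib

section
/- Suppose G is a locally countable Borel graph on a standard Borel space X in which every vertex has degree ≥ 2, D is a partial Borel directing of G with no sources and no sinks, and every connected component of G contains at least one vertex incident to an edge of D. Then D can be extended to a total Borel directing D* of G that has no sources and no sinks. -/
open Set Filter Topology MeasureTheory

namespace LusinNovikov

section Measurable

variable {X Y : Type*} [MeasurableSpace X] [MeasurableSpace Y]

/-- A countable union of Borel graphs of partial functions. -/
def IsGraphUnion (S : Set (X × Y)) : Prop :=
  ∃ F : Set (Set (X × Y)), F.Countable ∧ (∀ A ∈ F, MeasurableSet A ∧ A.InjOn Prod.fst) ∧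
    S = ⋃₀ F

lemma IsGraphUnion.iUnion {ι : Type*} [Countable ι] {S : ι → Set (X × Y)}
    (h : ∀ i, IsGraphUnion (S i)) : IsGraphUnion (⋃ i, S i) := by
  choose F hc hF hS using h
  refine ⟨⋃ i, F i, countable_iUnion hc, ?_, ?_⟩
  · intro A hA
    obtain ⟨i, hi⟩ := mem_iUnion.1 hA
    exact hF i A hi
  · rw [sUnion_iUnion]
    exact iUnion_congr hS

lemma IsGraphUnion.of_injOn {A : Set (X × Y)} (hA : MeasurableSet A) (h : A.InjOn Prod.fst) :
    IsGraphUnion A :=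
  ⟨{A}, countable_singleton A, by rintro B rfl; exact ⟨hA, h⟩, by simp⟩

lemma IsGraphUnion.union {S T : Set (X × Y)} (hS : IsGraphUnion S) (hT : IsGraphUnion T) :
    IsGraphUnion (S ∪ T) := by
  obtain ⟨F, hc, hF, rfl⟩ := hS
  obtain ⟨F', hc', hF', rfl⟩ := hT
  refine ⟨F ∪ F', hc.union hc', ?_, (sUnion_union F F').symm⟩
  rintro A (hA | hA)
  exacts [hF A hA, hF' A hA]

lemma IsGraphUnion.measurableSet {S : Set (X × Y)} (hS : IsGraphUnion S) : MeasurableSet S := by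
  obtain ⟨F, hc, hF, rfl⟩ := hS
  exact MeasurableSet.sUnion hc fun A hA => (hF A hA).1

/-- The points `φ (v i)` lie outside `S` and in a common vertical section. -/
def IsFiberTuple (φ : (ℕ → ℕ) → X × Y) (S : Set (X × Y)) {ι : Type*} (v : ι → ℕ → ℕ) : Prop :=
  (∀ i j, (φ (v i)).1 = (φ (v j)).1) ∧ ∀ i, φ (v i) ∉ S

/-- There is a countable union `S₀` of Borel partial graphs such that every cylinder constraint met
by a fiber tuple outside `S₀` is met by a fiber tuple outside any given such union. -/
lemma exists_universal_isGraphUnion (φ : (ℕ → ℕ) → X × Y) :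
    ∃ S₀ : Set (X × Y), IsGraphUnion S₀ ∧ ∀ (n k : ℕ) (v : (Fin n → Bool) → ℕ → ℕ),
      IsFiberTuple φ S₀ v → ∀ S, IsGraphUnion S →
        ∃ w : (Fin n → Bool) → ℕ → ℕ, (∀ i, w i ∈ PiNat.cylinder (v i) k) ∧
          IsFiberTuple φ S w := by
  let R : (Σ n k : ℕ, (Fin n → Bool) → Fin k → ℕ) → Set (X × Y) → Prop := fun c S =>
    ∃ w : (Fin c.1 → Bool) → ℕ → ℕ, (∀ i (m : Fin c.2.1), w i m = c.2.2 i m) ∧ IsFiberTuple φ S w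
  have hex : ∀ c, ∃ S, IsGraphUnion S ∧ ((∃ T, IsGraphUnion T ∧ ¬ R c T) → ¬ R c S) := by
    intro c
    by_cases h : ∃ T, IsGraphUnion T ∧ ¬ R c T
    · obtain ⟨T, hT, hR⟩ := h
      exact ⟨T, hT, fun _ => hR⟩
    · exact ⟨∅, .of_injOn .empty (injOn_empty _), fun h' => absurd h' h⟩
  choose S hS hR using hex
  refine ⟨⋃ c, S c, .iUnion hS, fun n k v hv T hT => ?_⟩
  let c : Σ n k : ℕ, (Fin n → Bool) → Fin k → ℕ := ⟨n, k, fun i m => v i m⟩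
  by_contra hcon
  refine hR c ⟨T, hT, ?_⟩ ⟨v, fun _ _ => rfl, hv.1, fun i hi => hv.2 i (mem_iUnion.2 ⟨c, hi⟩)⟩
  rintro ⟨w, hw, hwT⟩
  exact hcon ⟨w, fun i m hm => hw i ⟨m, hm⟩, hwT⟩

end Measurable

/-- Distinct values of a continuous function are separated on long enough cylinders. -/
lemma exists_cylinder_separation {Y : Type*} [TopologicalSpace Y] [T2Space Y]
    {f : (ℕ → ℕ) → Y} (hf : Continuous f) {a b : ℕ → ℕ}
    (h : f a ≠ f b) : ∃ k, ∀ z ∈ PiNat.cylinder a k, ∀ z' ∈ PiNat.cylinder b k, f z ≠ f z' := by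
  obtain ⟨U, V, hU, hV, haU, hbV, hUV⟩ := t2_separation h
  have key : ∀ (c : ℕ → ℕ) (W : Set Y), IsOpen W → f c ∈ W →
      ∃ k, PiNat.cylinder c k ⊆ f ⁻¹' W := by
    intro c W hW hc
    obtain ⟨_, ⟨x, n, rfl⟩, hx, hsub⟩ :=
      (PiNat.isTopologicalBasis_cylinders (fun _ : ℕ => ℕ)).exists_subset_of_mem_open
        (show c ∈ f ⁻¹' W from hc) (hW.preimage hf)
    exact ⟨n, by rwa [PiNat.mem_cylinder_iff_eq.1 hx]⟩
  obtain ⟨k, hk⟩ := key a U hU haU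
  obtain ⟨l, hl⟩ := key b V hV hbV
  refine ⟨max k l, fun z hz z' hz' he => Set.disjoint_left.1 hUV
    (hk (PiNat.cylinder_anti a (le_max_left k l) hz)) ?_⟩
  have := hl (PiNat.cylinder_anti b (le_max_right k l) hz')
  rwa [mem_preimage, ← he] at this

section Polish

variable {X Y : Type*} [TopologicalSpace X] [PolishSpace X] [MeasurableSpace X] [BorelSpace X]
  [TopologicalSpace Y] [PolishSpace Y] [MeasurableSpace Y] [BorelSpace Y]

/-- An analytic graph of a partial function is contained in a Borel one. -/
lemma exists_measurableSet_injOn_fst {S : Set (X × Y)} (hS : AnalyticSet S)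
    (hinj : S.InjOn Prod.fst) :
    ∃ A, S ⊆ A ∧ MeasurableSet A ∧ A.InjOn Prod.fst := by
  obtain ⟨V, hV, hsep⟩ := exists_seq_separating Y (p := MeasurableSet) MeasurableSet.empty univ
  have hana : ∀ W : Set Y, MeasurableSet W → AnalyticSet (Prod.fst '' (S ∩ Prod.snd ⁻¹' W)) := by
    intro W hW
    refine AnalyticSet.image_of_continuous ?_ continuous_fst
    have h2 : AnalyticSet (Prod.snd ⁻¹' W : Set (X × Y)) := (measurable_snd hW).analyticSet
    rw [inter_eq_iInter]
    exact AnalyticSet.iInter (by rintro (_ | _) <;> assumption)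
  have hQ : ∀ m, MeasurablySeparable (Prod.fst '' (S ∩ Prod.snd ⁻¹' V m))
      (Prod.fst '' (S ∩ Prod.snd ⁻¹' (V m)ᶜ)) := by
    intro m
    refine (hana _ (hV m)).measurablySeparable (hana _ (hV m).compl) ?_
    rw [Set.disjoint_left]
    rintro _ ⟨p, ⟨hpS, hpV⟩, rfl⟩ ⟨q, ⟨hqS, hqV⟩, hpq⟩
    obtain rfl := hinj hqS hpS hpq
    exact hqV hpV
  choose Q hQ1 hQ2 hQm using hQ
  refine ⟨⋂ m, {p | p.2 ∈ V m ↔ p.1 ∈ Q m}, ?_, ?_, ?_⟩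
  · intro p hp
    refine mem_iInter.2 fun m => ⟨fun h => hQ1 m ⟨p, ⟨hp, h⟩, rfl⟩, fun h => ?_⟩
    by_contra hn
    exact Set.disjoint_left.1 (hQ2 m) ⟨p, ⟨hp, hn⟩, rfl⟩ h
  · exact MeasurableSet.iInter fun m =>
      (measurable_snd (hV m)).iff (measurable_fst (hQm m))
  · intro p hp q hq hpq
    refine Prod.ext hpq (hsep _ trivial _ trivial fun m => ?_)
    have h1 : p.2 ∈ V m ↔ p.1 ∈ Q m := mem_iInter.1 hp m
    have h2 : q.2 ∈ V m ↔ q.1 ∈ Q m := mem_iInter.1 hq m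
    rw [h1, h2, hpq]

/-- Splitting one coordinate of a fiber tuple. -/
lemma exists_split_one {φ : (ℕ → ℕ) → X × Y} (hφ : Continuous φ) {S₀ : Set (X × Y)}
    (hS₀ : IsGraphUnion S₀) {ι : Type*} [Finite ι] {k : ℕ} {v : ι → ℕ → ℕ}
    (huniv : ∀ S, IsGraphUnion S →
      ∃ w : ι → ℕ → ℕ, (∀ i, w i ∈ PiNat.cylinder (v i) k) ∧ IsFiberTuple φ S w) (i₀ : ι) :
    ∃ (w : ι → ℕ → ℕ) (z : ℕ → ℕ), (∀ i, w i ∈ PiNat.cylinder (v i) k) ∧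
      z ∈ PiNat.cylinder (v i₀) k ∧ IsFiberTuple φ S₀ w ∧ φ z ∉ S₀ ∧
      (φ z).1 = (φ (w i₀)).1 ∧ (φ z).2 ≠ (φ (w i₀)).2 := by
  by_contra! hcon
  let Z : Set (ι → ℕ → ℕ) := {w | (∀ i, w i ∈ PiNat.cylinder (v i) k) ∧ IsFiberTuple φ S₀ w}
  have hφm : Measurable φ := hφ.measurable
  have hev : ∀ i, Measurable fun w : ι → ℕ → ℕ => φ (w i) := fun i =>
    hφm.comp (measurable_pi_apply i)
  have hZ : MeasurableSet Z := by
    have hZeq : Z = (⋂ i, (fun w : ι → ℕ → ℕ => w i) ⁻¹' PiNat.cylinder (v i) k) ∩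
        ((⋂ i, ⋂ j, {w : ι → ℕ → ℕ | (φ (w i)).1 = (φ (w j)).1}) ∩
          ⋂ i, {w : ι → ℕ → ℕ | φ (w i) ∉ S₀}) := by
      ext w
      simp [Z, IsFiberTuple]
    rw [hZeq]
    refine .inter (.iInter fun i => measurable_pi_apply i
      (PiNat.isOpen_cylinder (fun _ => ℕ) (v i) k).measurableSet)
      (.inter (.iInter fun i => .iInter fun j => measurableSet_eq_fun (hev i).fst (hev j).fst)
        (.iInter fun i => hev i hS₀.measurableSet.compl))
  obtain ⟨A, hSA, hAm, hAinj⟩ := exists_measurableSet_injOn_fst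
    (hZ.analyticSet_image (hev i₀)) (by
      rintro _ ⟨w, hw, rfl⟩ _ ⟨w', hw', rfl⟩ h
      exact Prod.ext h (hcon w' (w i₀) hw'.1 (hw.1 i₀) hw'.2 (hw.2.2 i₀) h))
  obtain ⟨w, hw, hwS⟩ := huniv (S₀ ∪ A) (hS₀.union (.of_injOn hAm hAinj))
  exact hwS.2 i₀ (Or.inr (hSA ⟨w, ⟨hw, hwS.1, fun i hi => hwS.2 i (Or.inl hi)⟩, rfl⟩))

/-- Splitting all coordinates of a fiber tuple. -/
lemma exists_split_all {φ : (ℕ → ℕ) → X × Y} (hφ : Continuous φ) {S₀ : Set (X × Y)}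
    (hS₀ : IsGraphUnion S₀) (huniv : ∀ (n k : ℕ) (v : (Fin n → Bool) → ℕ → ℕ),
      IsFiberTuple φ S₀ v → ∀ S, IsGraphUnion S →
        ∃ w : (Fin n → Bool) → ℕ → ℕ, (∀ i, w i ∈ PiNat.cylinder (v i) k) ∧
          IsFiberTuple φ S w)
    {n : ℕ} (k : ℕ) {v : (Fin n → Bool) → ℕ → ℕ} (hv : IsFiberTuple φ S₀ v) :
    ∃ (w : (Fin (n + 1) → Bool) → ℕ → ℕ) (l : ℕ), k < l ∧ IsFiberTuple φ S₀ w ∧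
      (∀ j, w j ∈ PiNat.cylinder (v (Fin.init j)) k) ∧
      ∀ i, ∀ z ∈ PiNat.cylinder (w (Fin.snoc i false)) l,
        ∀ z' ∈ PiNat.cylinder (w (Fin.snoc i true)) l, (φ z).2 ≠ (φ z').2 := by
  suffices H : ∀ T : Finset (Fin n → Bool), ∃ (w : (Fin (n + 1) → Bool) → ℕ → ℕ) (l : ℕ), k < l ∧
      IsFiberTuple φ S₀ w ∧ (∀ j, w j ∈ PiNat.cylinder (v (Fin.init j)) k) ∧
      ∀ i ∈ T, ∀ z ∈ PiNat.cylinder (w (Fin.snoc i false)) l,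
        ∀ z' ∈ PiNat.cylinder (w (Fin.snoc i true)) l, (φ z).2 ≠ (φ z').2 by
    obtain ⟨w, l, h1, h2, h3, h4⟩ := H Finset.univ
    exact ⟨w, l, h1, h2, h3, fun i => h4 i (Finset.mem_univ i)⟩
  intro T
  induction T using Finset.induction_on with
  | empty =>
    exact ⟨fun j => v (Fin.init j), k + 1, k.lt_succ_self, ⟨fun i j => hv.1 _ _, fun i => hv.2 _⟩,
      fun j => PiNat.self_mem_cylinder _ _, by simp⟩
  | insert i₀ T hi₀ ih =>
    obtain ⟨w, l, hkl, hw, hwv, hsep⟩ := ih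
    obtain ⟨u, z, hu, hz, huS, hzS, hz1, hz2⟩ := exists_split_one hφ hS₀
      (huniv (n + 1) l w hw) (Fin.snoc i₀ false)
    obtain ⟨l', hl'⟩ := exists_cylinder_separation (hφ.snd) hz2.symm
    have hne : ∀ i, (Fin.snoc i false : Fin (n + 1) → Bool) ≠ Fin.snoc i₀ true := fun i h => by
      simpa using congrFun h (Fin.last n)
    have hne' : ∀ i, i ≠ i₀ → (Fin.snoc i true : Fin (n + 1) → Bool) ≠ Fin.snoc i₀ true :=
      fun i hi h => hi (by simpa using congrArg Fin.init h)
    have hcyl : ∀ {a b c : ℕ → ℕ} {p q : ℕ}, p ≤ q → a ∈ PiNat.cylinder b q →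
        b ∈ PiNat.cylinder c p → a ∈ PiNat.cylinder c p := fun hpq ha hb m hm =>
      (ha m (hm.trans_le hpq)).trans (hb m hm)
    refine ⟨Function.update u (Fin.snoc i₀ true) z, max l l', lt_max_of_lt_left hkl, ⟨?_, ?_⟩,
      ?_, ?_⟩
    · have h1 : ∀ i, (φ (Function.update u (Fin.snoc i₀ true) z i)).1
          = (φ (u (Fin.snoc i₀ false))).1 := by
        intro i
        by_cases hi : i = Fin.snoc i₀ true
        · subst hi; simpa using hz1
        · simpa [hi] using huS.1 _ _
      exact fun i j => (h1 i).trans (h1 j).symm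
    · intro i
      by_cases hi : i = Fin.snoc i₀ true
      · subst hi; simpa using hzS
      · simpa [hi] using huS.2 _
    · intro i
      by_cases hi : i = Fin.snoc i₀ true
      · subst hi
        have := hwv (Fin.snoc i₀ false)
        simp only [Fin.init_snoc, Function.update_self] at this ⊢
        exact hcyl hkl.le hz this
      · simpa [hi] using hcyl hkl.le (hu i) (hwv i)
    · intro i hi x hx x' hx'
      rw [Function.update_of_ne (hne i)] at hx
      by_cases hii : i = i₀
      · subst hii
        rw [Function.update_self] at hx'
        exact hl' x (PiNat.cylinder_anti _ (le_max_right _ _) hx) x'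
          (PiNat.cylinder_anti _ (le_max_right _ _) hx')
      · rw [Function.update_of_ne (hne' i hii)] at hx'
        exact hsep i (Finset.mem_of_mem_insert_of_ne hi hii)
          x (hcyl (le_max_left _ _) hx (hu _))
          x' (hcyl (le_max_left _ _) hx' (hu _))

/-- An analytic set with countable vertical sections is covered by countably many Borel graphs of
partial functions. -/
theorem exists_isGraphUnion_superset {B : Set (X × Y)} (hB : AnalyticSet B)
    (hc : ∀ x, {y | (x, y) ∈ B}.Countable) : ∃ S, IsGraphUnion S ∧ B ⊆ S := by
  rw [AnalyticSet] at hB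
  rcases hB with rfl | ⟨φ, hφ, rfl⟩
  · exact ⟨∅, .of_injOn .empty (injOn_empty _), Subset.rfl⟩
  obtain ⟨S₀, hS₀, huniv⟩ := exists_universal_isGraphUnion φ
  refine ⟨S₀, hS₀, ?_⟩
  rintro _ ⟨z₀, rfl⟩
  by_contra hz₀
  let State : ℕ → Type := fun n =>
    {p : ((Fin n → Bool) → ℕ → ℕ) × ℕ // IsFiberTuple φ S₀ p.1}
  have hstep : ∀ n (s : State n), ∃ s' : State (n + 1), s.1.2 < s'.1.2 ∧
      (∀ j, s'.1.1 j ∈ PiNat.cylinder (s.1.1 (Fin.init j)) s.1.2) ∧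
      ∀ i, ∀ z ∈ PiNat.cylinder (s'.1.1 (Fin.snoc i false)) s'.1.2,
        ∀ z' ∈ PiNat.cylinder (s'.1.1 (Fin.snoc i true)) s'.1.2, (φ z).2 ≠ (φ z').2 := by
    intro n s
    obtain ⟨w, l, h1, h2, h3, h4⟩ := exists_split_all hφ hS₀ huniv s.1.2 s.2
    exact ⟨⟨(w, l), h2⟩, h1, h3, h4⟩
  choose step hk hcyl hsep using hstep
  let seq : ∀ n, State n := fun n =>
    Nat.rec (motive := State) ⟨(fun _ => z₀, 0), fun _ _ => rfl, fun _ => hz₀⟩ step n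
  let a : (ℕ → Bool) → ℕ → ℕ → ℕ := fun α n => (seq n).1.1 fun i => α i
  let k : ℕ → ℕ := fun n => (seq n).1.2
  have hkmono : StrictMono k := strictMono_nat_of_lt_succ fun n => hk n (seq n)
  have hagree : ∀ α n d, ∀ m < k n, a α (n + d) m = a α n m := by
    intro α n d
    induction d with
    | zero => exact fun m _ => rfl
    | succ d ih =>
      intro m hm
      exact (hcyl (n + d) (seq (n + d)) (fun i => α i) m
        (hm.trans_le (hkmono.monotone (Nat.le_add_right n d)))).trans (ih m hm)
  let z : (ℕ → Bool) → ℕ → ℕ := fun α m => a α (m + 1) m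
  have hz : ∀ α n, z α ∈ PiNat.cylinder (a α n) (k n) := by
    intro α n m hm
    rcases le_total n (m + 1) with h | h
    · obtain ⟨d, hd⟩ := Nat.exists_eq_add_of_le h
      simp only [z]
      rw [hd]
      exact hagree α n d m hm
    · obtain ⟨d, hd⟩ := Nat.exists_eq_add_of_le h
      rw [hd]
      exact (hagree α (m + 1) d m (m.lt_succ_self.trans_le (hkmono.le_apply))).symm
  have hlim : ∀ α, Tendsto (a α) atTop (𝓝 (z α)) := by
    intro α
    refine tendsto_pi_nhds.2 fun m => tendsto_const_nhds.congr' ?_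
    filter_upwards [eventually_gt_atTop m] with n hn
    exact hz α n m (hn.trans_le hkmono.le_apply)
  have hfst : ∀ α β, (φ (z α)).1 = (φ (z β)).1 := fun α β =>
    tendsto_nhds_unique ((hφ.fst.tendsto _).comp (hlim α))
      (((hφ.fst.tendsto _).comp (hlim β)).congr fun n => (seq n).2.1 _ _)
  have hres : ∀ (α : ℕ → Bool) (n : ℕ),
      (fun i : Fin (n + 1) => α i) =
        Fin.snoc (α := fun _ => Bool) (fun i : Fin n => α i) (α n) :=
    fun _ _ => (Fin.snoc_init_self (α := fun _ => Bool) _).symm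
  have hsep' : ∀ (α β : ℕ → Bool) (n : ℕ), (∀ m < n, α m = β m) → α n = false → β n = true →
      (φ (z α)).2 ≠ (φ (z β)).2 := by
    intro α β n hm hα hβ
    have h1 := hz α (n + 1)
    have h2 := hz β (n + 1)
    simp only [a] at h1 h2
    rw [hres, hα] at h1
    rw [hres, hβ, show (fun i : Fin n => β i) = fun i : Fin n => α i from
      funext fun i => (hm i i.2).symm] at h2
    exact hsep n (seq n) _ _ h1 _ h2
  have hinj : Function.Injective fun α => (φ (z α)).2 := by
    intro α β h
    by_contra hne
    have hlt : ∀ m < PiNat.firstDiff α β, α m = β m := fun m hm =>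
      PiNat.apply_eq_of_lt_firstDiff hm
    have hd := PiNat.apply_firstDiff_ne hne
    cases hα : α (PiNat.firstDiff α β) <;> cases hβ : β (PiNat.firstDiff α β)
    · exact hd (hα.trans hβ.symm)
    · exact hsep' α β _ hlt hα hβ h
    · exact hsep' β α _ (fun m hm => (hlt m hm).symm) hβ hα h.symm
    · exact hd (hα.trans hβ.symm)
  have hcount : Countable (ℕ → Bool) := by
    have := (hc (φ (z fun _ => false)).1).to_subtype
    have hmem : ∀ α, (φ (z α)).2 ∈ {y | ((φ (z fun _ => false)).1, y) ∈ range φ} := fun α =>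
      ⟨z α, Prod.ext (hfst α fun _ => false) rfl⟩
    exact Function.Injective.countable (f := fun α => (⟨(φ (z α)).2, hmem α⟩ :
      {y | ((φ (z fun _ => false)).1, y) ∈ range φ})) fun α β h => hinj (congrArg Subtype.val h)
  obtain ⟨g, hg⟩ := exists_surjective_nat (ℕ → Bool)
  obtain ⟨n, hn⟩ := hg fun n => !g n n
  simpa using congrFun hn n

end Polish

/-- A function between standard Borel spaces with Borel graph is Borel. -/
lemma measurable_of_measurableSet_graph {X Y : Type*} [MeasurableSpace X] [StandardBorelSpace X]
    [MeasurableSpace Y] [StandardBorelSpace Y] {f : X → Y}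
    (hf : MeasurableSet {p : X × Y | f p.1 = p.2}) : Measurable f := by
  intro V hV
  have h : f ⁻¹' V = Prod.fst '' ({p : X × Y | f p.1 = p.2} ∩ Prod.snd ⁻¹' V) := by
    ext x
    simp
  rw [h]
  refine (hf.inter (measurable_snd hV)).image_of_measurable_injOn measurable_fst ?_
  rintro ⟨x, y⟩ ⟨h1, -⟩ ⟨x', y'⟩ ⟨h2, -⟩ (rfl : x = x')
  exact Prod.ext rfl (Eq.trans (Eq.symm h1) h2)

/-- The **Lusin–Novikov theorem**: a Borel set with nonempty countable vertical sections is a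
countable union of graphs of Borel functions. -/
theorem exists_measurable_seq {X Y : Type*} [MeasurableSpace X] [StandardBorelSpace X]
    [MeasurableSpace Y] [StandardBorelSpace Y] {B : Set (X × Y)} (hB : MeasurableSet B)
    (hne : ∀ x, ∃ y, (x, y) ∈ B) (hc : ∀ x, {y | (x, y) ∈ B}.Countable) :
    ∃ f : ℕ → X → Y, (∀ n, Measurable (f n)) ∧ ∀ x y, (x, y) ∈ B ↔ ∃ n, f n x = y := by
  let := upgradeStandardBorel X
  let := upgradeStandardBorel Y
  obtain ⟨S, ⟨F, hFc, hF, rfl⟩, hBS⟩ := exists_isGraphUnion_superset hB.analyticSet hc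
  obtain ⟨A, hA⟩ := (hFc.insert ∅).exists_eq_range (insert_nonempty _ _)
  have hAF : ∀ n, MeasurableSet (A n) ∧ (A n).InjOn Prod.fst := by
    intro n
    rcases (hA ▸ mem_range_self n : A n ∈ insert ∅ F) with h | h
    · rw [h]
      exact ⟨.empty, injOn_empty _⟩
    · exact hF _ h
  have hBA : ∀ p ∈ B, ∃ n, p ∈ B ∩ A n := by
    intro p hp
    obtain ⟨T, hT, hpT⟩ := hBS hp
    obtain ⟨n, rfl⟩ : T ∈ range A := hA ▸ mem_insert_of_mem _ hT
    exact ⟨n, hp, hpT⟩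
  let dom : ℕ → Set X := fun n => Prod.fst '' (B ∩ A n)
  have hdom : ∀ n, MeasurableSet (dom n) := fun n =>
    (hB.inter (hAF n).1).image_of_measurable_injOn measurable_fst
      ((hAF n).2.mono inter_subset_right)
  let E : ℕ → Set (X × Y) := fun n => {p | p ∈ B ∩ A n ∨
    p.1 ∉ dom n ∧ ∃ m, p ∈ B ∩ A m ∧ ∀ l < m, p.1 ∉ dom l}
  have hE : ∀ n, MeasurableSet (E n) := by
    intro n
    have hEn : E n = B ∩ A n ∪ Prod.fst ⁻¹' (dom n)ᶜ ∩
        ⋃ m, B ∩ A m ∩ ⋂ l, ⋂ _ : l < m, Prod.fst ⁻¹' (dom l)ᶜ := by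
      ext p
      simp only [E, mem_ofPred_eq, mem_union, mem_inter_iff, mem_iUnion, mem_iInter, mem_preimage,
        mem_compl_iff]
    rw [hEn]
    exact (hB.inter (hAF n).1).union <| (measurable_fst (hdom n).compl).inter <|
      .iUnion fun m => (hB.inter (hAF m).1).inter <|
        .iInter fun l => .iInter fun _ => measurable_fst (hdom l).compl
  have huniq : ∀ n x y y', (x, y) ∈ B ∩ A n → (x, y') ∈ B ∩ A n → y = y' := fun n x y y' h h' =>
    congrArg Prod.snd ((hAF n).2 h.2 h'.2 rfl)
  have hEx : ∀ n x, ∃ y, (x, y) ∈ E n := by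
    intro n x
    by_cases hx : x ∈ dom n
    · obtain ⟨⟨_, y⟩, hy, rfl⟩ := hx
      exact ⟨y, Or.inl hy⟩
    · classical
      have hx' : ∃ m, x ∈ dom m := by
        obtain ⟨y, hy⟩ := hne x
        obtain ⟨m, hm⟩ := hBA _ hy
        exact ⟨m, _, hm, rfl⟩
      obtain ⟨⟨x', y⟩, hy, hxx⟩ := Nat.find_spec hx'
      obtain rfl : x' = x := hxx
      exact ⟨y, Or.inr ⟨hx, _, hy, fun l hl => Nat.find_min hx' hl⟩⟩
  have hEuniq : ∀ n x y y', (x, y) ∈ E n → (x, y') ∈ E n → y = y' := by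
    rintro n x y y' (h | ⟨h, m, hm, hml⟩) (h' | ⟨h', m', hm', hml'⟩)
    · exact huniq n x y y' h h'
    · exact absurd ⟨_, h, rfl⟩ h'
    · exact absurd ⟨_, h', rfl⟩ h
    · have h1 : m ≤ m' := not_lt.1 fun hlt => hml _ hlt ⟨_, hm', rfl⟩
      have h2 : m' ≤ m := not_lt.1 fun hlt => hml' _ hlt ⟨_, hm, rfl⟩
      obtain rfl := le_antisymm h1 h2
      exact huniq m x y y' hm hm'
  choose f hf using hEx
  refine ⟨f, fun n => measurable_of_measurableSet_graph ?_, fun x y => ⟨fun h => ?_, ?_⟩⟩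
  · convert hE n using 1
    ext ⟨x, y⟩
    exact ⟨fun h => (show f n x = y from h) ▸ hf n x, fun h => hEuniq n x _ _ (hf n x) h⟩
  · obtain ⟨n, hn⟩ := hBA _ h
    exact ⟨n, hEuniq n x _ _ (hf n x) (Or.inl hn)⟩
  · rintro ⟨n, rfl⟩
    rcases hf n x with h | ⟨-, m, h, -⟩
    exacts [h.1, h.1]

end LusinNovikov

/-- A Borel choice, from the range of a sequence of Borel functions, of a point satisfying a Borel
relation whenever there is one. -/
lemma exists_measurable_select {X Y : Type*} [MeasurableSpace X] [MeasurableSpace Y]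
    {f : ℕ → X → Y} (hf : ∀ n, Measurable (f n)) {R : X → Y → Prop}
    (hR : Measurable fun q : X × Y => R q.1 q.2) :
    ∃ g : X → Y, Measurable g ∧ ∀ x, ∃ n, g x = f n x ∧ ∀ m, R x (f m x) → R x (g x) := by
  classical
  have hRf : ∀ n, Measurable fun x => R x (f n x) := fun n =>
    hR.comp (measurable_id.prodMk (hf n))
  have hex : ∀ x, ∃ n, R x (f n x) ∨ ∀ m, ¬ R x (f m x) := by
    intro x
    by_cases h : ∃ n, R x (f n x)
    · exact h.imp fun n hn => Or.inl hn
    · exact ⟨0, Or.inr (not_exists.1 h)⟩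
  refine ⟨_, Measurable.find hf (fun n => measurableSet_setOfPred.2 <|
    (hRf n).or (Measurable.forall fun m => (hRf m).not)) hex, fun x => ⟨_, rfl, fun m hm => ?_⟩⟩
  exact (Nat.find_spec (hex x)).resolve_right fun h => h m hm

/-- If every vertex can reach the Borel set `A`, then there is a Borel choice, for the vertices
outside `A`, of a neighbor closer to `A`. -/
lemma exists_measurable_parent {X : Type*} [MeasurableSpace X] (G : SimpleGraph X)
    {f : ℕ → X → X} (hf : ∀ n, Measurable (f n)) (hadj : ∀ x y, G.Adj x y ↔ ∃ n, f n x = y)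
    {A : Set X} (hA : MeasurableSet A) (hreach : ∀ x, ∃ y ∈ A, G.Reachable x y) :
    ∃ (d : X → ℕ) (p : X → X), Measurable p ∧ ∀ x ∉ A, G.Adj x (p x) ∧ d (p x) < d x := by
  classical
  let L : ℕ → Set X := fun n =>
    Nat.rec (motive := fun _ => Set X) A (fun _ S => S ∪ ⋃ k, f k ⁻¹' S) n
  have hL : ∀ n, MeasurableSet (L n) := by
    intro n
    induction n with
    | zero => exact hA
    | succ n ih => exact ih.union (.iUnion fun k => hf k ih)
  have hLadj : ∀ n x y, G.Adj x y → y ∈ L n → x ∈ L (n + 1) := by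
    intro n x y hxy hy
    obtain ⟨k, rfl⟩ := (hadj x y).1 hxy
    exact Or.inr (mem_iUnion.2 ⟨k, hy⟩)
  have hex : ∀ x, ∃ n, x ∈ L n := by
    intro x
    obtain ⟨y, hy, ⟨w⟩⟩ := hreach x
    induction w with
    | nil => exact ⟨0, hy⟩
    | cons h _ ih =>
      obtain ⟨n, hn⟩ := ih hy
      exact ⟨n + 1, hLadj n _ _ h hn⟩
  let d : X → ℕ := fun x => Nat.find (hex x)
  have hd : Measurable d := measurable_find (p := fun x n => x ∈ L n) hex hL
  obtain ⟨p, hp, hsel⟩ := exists_measurable_select hf (R := fun x y => d y < d x)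
    (measurableSet_setOfPred.1 (measurableSet_lt (hd.comp measurable_snd) (hd.comp measurable_fst)))
  refine ⟨d, p, hp, fun x hx => ?_⟩
  obtain ⟨n, hn, hm⟩ := hsel x
  refine ⟨(hadj x _).2 ⟨n, hn.symm⟩, ?_⟩
  obtain ⟨k, hk⟩ := Nat.exists_eq_succ_of_ne_zero (n := d x) fun h0 => hx <| by
    have := Nat.find_spec (hex x)
    rwa [show Nat.find (hex x) = 0 from h0] at this
  have hxk : x ∈ L (k + 1) := by
    have := Nat.find_spec (hex x)
    rwa [show Nat.find (hex x) = k + 1 from hk] at this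
  have hxk' : x ∉ L k := Nat.find_min (p := fun n => x ∈ L n) (hex x) (by
    rw [show Nat.find (hex x) = k + 1 from hk]
    exact k.lt_succ_self)
  obtain ⟨m, hm'⟩ := mem_iUnion.1 (hxk.resolve_left hxk')
  exact hm m ((Nat.find_min' (p := fun n => f m x ∈ L n) (hex (f m x)) hm').trans_lt
    (by rw [hk]; exact k.lt_succ_self))

/-- The direction rule: given a choice `p` of neighbors that decreases `d` outside of `A`, there is
a Borel tournament-like relation for which every vertex outside `A` has both an incoming and an
outgoing edge. -/
lemma exists_measurable_direction {X : Type*} [MeasurableSpace X] [StandardBorelSpace X]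
    (G : SimpleGraph X) {f : ℕ → X → X} (hf : ∀ n, Measurable (f n))
    (hadj : ∀ x y, G.Adj x y ↔ ∃ n, f n x = y) (hdeg : ∀ x, 2 ≤ (G.neighborSet x).encard)
    {A : Set X} (hA : MeasurableSet A) {d : X → ℕ} {p : X → X} (hp : Measurable p)
    (hpd : ∀ x ∉ A, G.Adj x (p x) ∧ d (p x) < d x) :
    ∃ T : X → X → Prop, (Measurable fun q : X × X => T q.1 q.2) ∧
      (∀ x y, x ≠ y → (T x y ↔ ¬ T y x)) ∧
      ∀ x ∉ A, (∃ y, G.Adj x y ∧ T x y) ∧ ∃ y, G.Adj x y ∧ T y x := by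
  obtain ⟨e, he, hsel⟩ := exists_measurable_select hf (R := fun x y => y ≠ p x)
    (measurable_snd.eq (hp.comp measurable_fst)).not
  have heG : ∀ x, G.Adj x (e x) ∧ e x ≠ p x := by
    intro x
    obtain ⟨n, hn, hm⟩ := hsel x
    refine ⟨(hadj x _).2 ⟨n, hn.symm⟩, ?_⟩
    obtain ⟨y, hy, hyp⟩ := (one_lt_encard_iff_nontrivial.1
      (lt_of_lt_of_le (by norm_num) (hdeg x))).exists_ne (p x)
    obtain ⟨m, rfl⟩ := (hadj x y).1 hy
    exact hm m hyp
  let r : X → ℝ := embeddingReal X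
  have hr : Measurable r := (measurableEmbedding_embeddingReal X).measurable
  have hrinj : Function.Injective r := (measurableEmbedding_embeddingReal X).injective
  let P : X → X → Prop := fun u v => u ∉ A ∧ p u = v
  let leaf : X → Prop := fun u => u ∉ A ∧ ∀ n, ¬ P (f n u) u
  let W : X → X → Prop := fun u v => leaf u ∧ e u = v
  let O : X → X → Prop := fun u v => (W u v ∧ ¬ W v u) ∨ ((W u v ↔ W v u) ∧ r u < r v)
  let N : ℕ → X → Prop := fun n =>
    Nat.rec (motive := fun _ => X → Prop) (fun u => leaf u ∧ O u (e u))
    (fun _ S u => ∃ k, P (f k u) u ∧ S (f k u)) n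
  let down : X → Prop := fun u => ∃ n, N n u
  let T : X → X → Prop := fun u v => (P u v ∧ ¬ down u) ∨ (P v u ∧ down v) ∨
    (¬ P u v ∧ ¬ P v u ∧ O u v)
  have hAm : Measurable fun x => x ∈ A := measurableSet_setOfPred.1 hA
  have hP : Measurable fun q : X × X => P q.1 q.2 :=
    (hAm.comp measurable_fst).not.and ((hp.comp measurable_fst).eq measurable_snd)
  have hleaf : Measurable leaf := hAm.not.and <| Measurable.forall fun n =>
    (hP.comp ((hf n).prodMk measurable_id)).not
  have hW : Measurable fun q : X × X => W q.1 q.2 :=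
    (hleaf.comp measurable_fst).and ((he.comp measurable_fst).eq measurable_snd)
  have hW' : Measurable fun q : X × X => W q.2 q.1 := hW.comp measurable_swap
  have hO : Measurable fun q : X × X => O q.1 q.2 :=
    (hW.and hW'.not).or <| (hW.iff hW').and <| measurableSet_setOfPred.1 <|
      measurableSet_lt (hr.comp measurable_fst) (hr.comp measurable_snd)
  have hN : ∀ n, Measurable (N n) := by
    intro n
    induction n with
    | zero => exact hleaf.and (hO.comp (measurable_id.prodMk he))
    | succ n ih =>
      exact Measurable.exists fun k =>
        (hP.comp ((hf k).prodMk measurable_id)).and (ih.comp (hf k))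
  have hdown : Measurable down := Measurable.exists hN
  have hP' : Measurable fun q : X × X => P q.2 q.1 := hP.comp measurable_swap
  have hT : Measurable fun q : X × X => T q.1 q.2 :=
    (hP.and (hdown.comp measurable_fst).not).or <| (hP'.and (hdown.comp measurable_snd)).or <|
      hP.not.and <| hP'.not.and hO
  have hPasymm : ∀ u v, P u v → ¬ P v u := by
    rintro u v ⟨hu, rfl⟩ ⟨hv, h⟩
    have h1 := (hpd u hu).2
    have h2 := (hpd _ hv).2
    rw [h] at h2
    exact lt_asymm h1 h2
  have hOxor : ∀ u v, u ≠ v → (O u v ↔ ¬ O v u) := by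
    intro u v huv
    have h1 : r u < r v ↔ ¬ r v < r u := by
      rw [not_lt]
      exact ⟨le_of_lt, fun h => h.lt_of_ne (hrinj.ne huv)⟩
    simp only [O]
    by_cases h2 : W u v <;> by_cases h3 : W v u <;> simp [h1, h2, h3]
  have hleaf' : ∀ u, leaf u → ∀ w, ¬ P w u := by
    rintro u ⟨-, hu⟩ w hw
    obtain ⟨n, rfl⟩ := (hadj u w).1 (hw.2 ▸ (hpd w hw.1).1).symm
    exact hu n hw
  have hchild : ∀ u w, P w u → down w → down u := by
    rintro u w hw ⟨n, hn⟩
    obtain ⟨k, rfl⟩ := (hadj u w).1 (hw.2 ▸ (hpd w hw.1).1).symm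
    exact ⟨n + 1, k, hw, hn⟩
  have hdown_cases : ∀ u, down u → (leaf u ∧ O u (e u)) ∨ ∃ w, P w u ∧ down w := by
    rintro u ⟨_ | n, hn⟩
    · exact Or.inl hn
    · obtain ⟨k, hk, hn⟩ := hn
      exact Or.inr ⟨_, hk, n, hn⟩
  have hPadj : ∀ u v, P u v → G.Adj u v := by
    rintro u _ ⟨hu, rfl⟩
    exact (hpd u hu).1
  have hTleaf : ∀ x, leaf x → ¬ P x (e x) ∧ ¬ P (e x) x := fun x hx =>
    ⟨fun h => (heG x).2 h.2.symm, hleaf' x hx _⟩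
  refine ⟨T, hT, ?_, fun x hx => ?_⟩
  · intro u v huv
    have h1 := hPasymm u v
    have h2 := hOxor u v huv
    simp only [T]
    by_cases h3 : P u v
    · simp [h3, h1 h3]
    · by_cases h4 : P v u <;> simp [h2, h3, h4]
  · have hPx : P x (p x) := ⟨hx, rfl⟩
    by_cases hd : down x
    · refine ⟨?_, p x, hPadj _ _ hPx, Or.inr (Or.inl ⟨hPx, hd⟩)⟩
      rcases hdown_cases x hd with ⟨hl, ho⟩ | ⟨w, hw, hdw⟩
      · exact ⟨e x, (heG x).1, Or.inr (Or.inr ⟨(hTleaf x hl).1, (hTleaf x hl).2, ho⟩)⟩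
      · exact ⟨w, (hPadj _ _ hw).symm, Or.inr (Or.inl ⟨hw, hdw⟩)⟩
    · refine ⟨⟨p x, hPadj _ _ hPx, Or.inl ⟨hPx, hd⟩⟩, ?_⟩
      by_cases hl : leaf x
      · have ho : O (e x) x := (hOxor _ _ (heG x).1.ne').2 fun h => hd ⟨0, hl, h⟩
        exact ⟨e x, (heG x).1, Or.inr (Or.inr ⟨(hTleaf x hl).2, (hTleaf x hl).1, ho⟩)⟩
      · obtain ⟨n, hn⟩ : ∃ n, P (f n x) x := by
          by_contra! h
          exact hl ⟨hx, h⟩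
        exact ⟨f n x, (hPadj _ _ hn).symm, Or.inl ⟨hn, fun h => hd (hchild _ _ hn h)⟩⟩

/-- Suppose `G` is a locally countable Borel graph on a standard Borel space `X` in which
every vertex has degree `≥ 2`, `D` is a partial Borel directing of `G` with no sources
and no sinks, and every connected component of `G` contains at least one vertex incident
to an edge of `D`. Then `D` extends to a total Borel directing of `G` with no sources
and no sinks. -/
theorem stmt_18 (X : Type) [MeasurableSpace X] [StandardBorelSpace X]
    (G : SimpleGraph X)
    (hGBorel : MeasurableSet {p : X × X | G.Adj p.1 p.2})
    (hGlc : ∀ x, (G.neighborSet x).Countable)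
    (hGdeg : ∀ x, 2 ≤ (G.neighborSet x).encard)
    (D : Set (X × X)) (hD : MeasurableSet D)
    (hDadj : ∀ p ∈ D, G.Adj p.1 p.2)
    (hDpartial : ∀ x y, (x, y) ∈ D → (y, x) ∉ D)
    (hDnosource : ∀ x, (∃ y, (x, y) ∈ D) → ∃ y, (y, x) ∈ D)
    (hDnosink : ∀ x, (∃ y, (y, x) ∈ D) → ∃ y, (x, y) ∈ D)
    (hcomp : ∀ x : X, ∃ y z, G.Reachable x y ∧ ((y, z) ∈ D ∨ (z, y) ∈ D)) :
    ∃ Dstar : Set (X × X),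
      MeasurableSet Dstar ∧ D ⊆ Dstar ∧
      (∀ p ∈ Dstar, G.Adj p.1 p.2) ∧
      (∀ x y, G.Adj x y → ((x, y) ∈ Dstar ↔ (y, x) ∉ Dstar)) ∧
      (∀ x, (∃ y, (x, y) ∈ Dstar) → ∃ y, (y, x) ∈ Dstar) ∧
      (∀ x, (∃ y, (y, x) ∈ Dstar) → ∃ y, (x, y) ∈ Dstar) := by
  obtain ⟨f, hf, hadj⟩ := LusinNovikov.exists_measurable_seq hGBorel (fun x => by
    obtain ⟨y, hy⟩ := nonempty_of_encard_ne_zero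
      (pos_iff_ne_zero.1 (lt_of_lt_of_le (by norm_num) (hGdeg x)))
    exact ⟨y, hy⟩) hGlc
  replace hadj : ∀ x y, G.Adj x y ↔ ∃ n, f n x = y := hadj
  let A : Set X := ⋃ n, {x | (x, f n x) ∈ D} ∪ {x | (f n x, x) ∈ D}
  have hA : MeasurableSet A := .iUnion fun n =>
    (measurable_id.prodMk (hf n) hD).union ((hf n).prodMk measurable_id hD)
  have hAmem : ∀ x y, (x, y) ∈ D ∨ (y, x) ∈ D → x ∈ A := by
    intro x y h
    obtain ⟨n, rfl⟩ := (hadj x y).1 (h.elim (hDadj _) fun h => (hDadj _ h).symm)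
    exact mem_iUnion.2 ⟨n, h⟩
  have hAD : ∀ x ∈ A, (∃ y, (x, y) ∈ D) ∧ ∃ y, (y, x) ∈ D := by
    intro x hx
    obtain ⟨n, h | h⟩ := mem_iUnion.1 hx
    · exact ⟨⟨_, h⟩, hDnosource x ⟨_, h⟩⟩
    · exact ⟨hDnosink x ⟨_, h⟩, ⟨_, h⟩⟩
  obtain ⟨d, p, hp, hpd⟩ := exists_measurable_parent G hf hadj hA fun x => by
    obtain ⟨y, z, hxy, h⟩ := hcomp x
    exact ⟨y, hAmem y z h, hxy⟩
  obtain ⟨T, hT, hTxor, hTA⟩ := exists_measurable_direction G hf hadj hGdeg hA hp hpd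
  let E : Set (X × X) := D ∪ ({q | G.Adj q.1 q.2} ∩ (Prod.swap ⁻¹' D)ᶜ ∩ {q | T q.1 q.2})
  have hE : ∀ x y, (x, y) ∈ E ↔ (x, y) ∈ D ∨ (G.Adj x y ∧ (y, x) ∉ D) ∧ T x y :=
    fun x y => Iff.rfl
  have hboth : ∀ x, (∃ y, (x, y) ∈ E) ∧ ∃ y, (y, x) ∈ E := by
    intro x
    by_cases hx : x ∈ A
    · exact (hAD x hx).imp (fun ⟨y, hy⟩ => ⟨y, Or.inl hy⟩) fun ⟨y, hy⟩ => ⟨y, Or.inl hy⟩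
    · obtain ⟨⟨y, hy, hxy⟩, z, hz, hzx⟩ := hTA x hx
      exact ⟨⟨y, Or.inr ⟨⟨hy, fun h => hx (hAmem x y (Or.inr h))⟩, hxy⟩⟩,
        ⟨z, Or.inr ⟨⟨hz.symm, fun h => hx (hAmem x z (Or.inl h))⟩, hzx⟩⟩⟩
  refine ⟨E, hD.union ((hGBorel.inter (measurable_swap hD).compl).inter
    (measurableSet_setOfPred.2 hT)), subset_union_left, ?_, ?_, fun x _ => (hboth x).2, fun x _ => (hboth x).1⟩
  · rintro q (h | h)
    exacts [hDadj q h, h.1.1]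
  · intro x y hxy
    have h1 := hTxor x y hxy.ne
    have h2 := hDpartial x y
    have h3 := hxy.symm
    rw [hE, hE]
    tauto
end

section
/- Suppose G is a 3-regular Borel bipartite graph on a standard Borel space X and μ is a Borel probability measure on X. Then G has a Borel edge coloring with 4 colors modulo a μ-null set: there is a Borel set X' ⊆ X with μ(X \ X') = 0 that is a union of connected components of G, such that the restriction of G to X' admits a Borel edge coloring with 4 colors. -/
open MeasureTheory

namespace CubicEdge

/-- Greedy list coloring along decreasing rank: every vertex has a color left, even after excluding
its forbidden colors and the colors of its neighbors of at least the same rank. -/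
lemma exists_greedy_coloring {Y : Type*} (P : Finset Y) (adj : Y → Y → Prop)
    (hsymm : ∀ x y, adj x y → adj y x) (hirr : ∀ x, ¬ adj x x) (d : Y → ℕ)
    (F : Y → Finset (Fin 4))
    (h : ∀ q ∈ P, ∃ N : Finset Y, (∀ x ∈ P, adj q x → d q ≤ d x → x ∈ N) ∧
      (F q).card + N.card < 4) :
    ∃ φ : Y → Fin 4, ∀ q ∈ P, φ q ∉ F q ∧ ∀ x ∈ P, adj q x → φ q ≠ φ x := by
  classical
  suffices H : ∀ s : Finset Y, s ⊆ P →
      ∃ φ : Y → Fin 4, ∀ q ∈ s, φ q ∉ F q ∧ ∀ x ∈ s, adj q x → φ q ≠ φ x from H P subset_rfl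
  intro s
  induction s using Finset.induction_on_min_value d with
  | empty => exact fun _ => ⟨fun _ => 0, by simp⟩
  | insert a s ha hmin ih =>
    intro hs
    obtain ⟨φ, hφ⟩ := ih ((Finset.subset_insert _ _).trans hs)
    obtain ⟨N, hN, hcard⟩ := h a (hs (Finset.mem_insert_self _ _))
    obtain ⟨k, hk⟩ : ∃ k : Fin 4, k ∉ F a ∪ N.image φ := by
      by_contra! hall
      have h1 : (Finset.univ : Finset (Fin 4)) ⊆ F a ∪ N.image φ := fun k _ => hall k
      have h2 := Finset.card_le_card h1
      have h3 := Finset.card_union_le (F a) (N.image φ)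
      have h4 : (N.image φ).card ≤ N.card := Finset.card_image_le
      simp only [Finset.card_univ, Fintype.card_fin] at h2
      omega
    simp only [Finset.mem_union, Finset.mem_image, not_or, not_exists, not_and] at hk
    have hka : ∀ x ∈ s, adj a x → φ x ≠ k := fun x hx hax =>
      hk.2 x (hN x (hs (Finset.mem_insert_of_mem hx)) hax (hmin x hx))
    refine ⟨Function.update φ a k, fun q hq => ?_⟩
    rcases Finset.mem_insert.1 hq with rfl | hqs
    · refine ⟨by simpa using hk.1, fun x hx hax => ?_⟩
      rcases Finset.mem_insert.1 hx with rfl | hx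
      · exact (hirr _ hax).elim
      · have hne : x ≠ q := fun e => ha (e ▸ hx)
        simpa [hne] using (hka x hx hax).symm
    · have hne : q ≠ a := fun e => ha (e ▸ hqs)
      refine ⟨by simpa [hne] using (hφ q hqs).1, fun x hx hax => ?_⟩
      rcases Finset.mem_insert.1 hx with rfl | hx
      · simpa [hne] using hka q hqs (hsymm _ _ hax)
      · have hne' : x ≠ a := fun e => ha (e ▸ hx)
        simpa [hne, hne'] using (hφ q hqs).2 x hx hax

/-- `ReachIn r q n x` says that `x` is reached from `q` in `n` steps of `r`. -/
inductive ReachIn {Y : Type*} (r : Y → Y → Prop) (q : Y) : ℕ → Y → Prop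
  | zero : ReachIn r q 0 q
  | succ {n x y} : ReachIn r q n x → r x y → ReachIn r q (n + 1) y

lemma exists_rank {Y : Type*} (P : Finset Y) (adj : Y → Y → Prop)
    (hsymm : ∀ x y, adj x y → adj y x) (q₀ : Y) (hq₀ : q₀ ∈ P)
    (conn : ∀ Z ⊆ P, q₀ ∈ Z → (∀ z ∈ Z, ∀ x ∈ P, adj z x → x ∈ Z) → Z = P) :
    ∃ d : Y → ℕ, ∀ q ∈ P, q ≠ q₀ → ∃ x ∈ P, adj q x ∧ d x < d q := by
  classical
  set r : Y → Y → Prop := fun x y => adj x y ∧ y ∈ P with hr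
  have hreach : ∀ q ∈ P, ∃ n, ReachIn r q₀ n q := by
    have := conn (P.filter fun q => ∃ n, ReachIn r q₀ n q) (Finset.filter_subset _ _)
      (Finset.mem_filter.2 ⟨hq₀, 0, .zero⟩) (by
        intro z hz x hx hzx
        obtain ⟨-, n, hn⟩ := Finset.mem_filter.1 hz
        exact Finset.mem_filter.2 ⟨hx, n + 1, .succ hn ⟨hzx, hx⟩⟩)
    intro q hq
    rw [← this] at hq
    exact (Finset.mem_filter.1 hq).2
  refine ⟨fun q => sInf {n | ReachIn r q₀ n q}, fun q hq hne => ?_⟩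
  have hmem : ReachIn r q₀ (sInf {n | ReachIn r q₀ n q}) q := Nat.sInf_mem (hreach q hq)
  generalize hn : sInf {n | ReachIn r q₀ n q} = n at hmem
  cases hmem with
  | zero => exact (hne rfl).elim
  | @succ n x _ hx hxq =>
    have hxP : x ∈ P := by
      cases hx with
      | zero => exact hq₀
      | succ _ h => exact h.2
    refine ⟨x, hxP, hsymm _ _ hxq.1, ?_⟩
    have : sInf {n | ReachIn r q₀ n x} ≤ n := Nat.sInf_le hx
    simp only [hn]
    omega

/-- Even cycles, presented by two fixed-point free involutions, are colorable from lists of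
two colors. -/
lemma exists_cycle_coloring {Y : Type*} (P : Finset Y) (m : Bool → Y → Y)
    (hm : ∀ q ∈ P, ∀ b, m b q ∈ P) (inv : ∀ q ∈ P, ∀ b, m b (m b q) = q)
    (ne : ∀ q ∈ P, ∀ b, m b q ≠ q) (ne' : ∀ q ∈ P, ∀ b, m b q ≠ m (!b) q)
    (conn : ∀ Z ⊆ P, Z.Nonempty → (∀ z ∈ Z, ∀ b, m b z ∈ Z) → Z = P)
    (F : Y → Finset (Fin 4)) (hF : ∀ q ∈ P, (F q).card ≤ 2) :
    ∃ φ : Y → Fin 4, ∀ q ∈ P, φ q ∉ F q ∧ ∀ b, φ q ≠ φ (m b q) := by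
  classical
  rcases P.eq_empty_or_nonempty with rfl | ⟨p₀, hp₀⟩
  · exact ⟨fun _ => 0, by simp⟩
  choose! E hFE hE using fun q (hq : q ∈ P) =>
    Finset.exists_superset_card_eq (hF q hq) (by simp : 2 ≤ Fintype.card (Fin 4))
  obtain ⟨q₁, b₀, hq₁, hcase⟩ : ∃ q₁ b₀, q₁ ∈ P ∧
      (E (m b₀ q₁) ≠ E q₁ ∨ ∀ q ∈ P, E q = E q₁) := by
    by_cases h : ∃ q₁ b₀, q₁ ∈ P ∧ E (m b₀ q₁) ≠ E q₁
    · obtain ⟨q₁, b₀, h1, h2⟩ := h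
      exact ⟨q₁, b₀, h1, Or.inl h2⟩
    · push Not at h
      refine ⟨p₀, true, hp₀, Or.inr ?_⟩
      have := conn (P.filter fun q => E q = E p₀) (Finset.filter_subset _ _)
        ⟨p₀, by simp [hp₀]⟩ (by
          intro z hz b
          obtain ⟨h1, h2⟩ := Finset.mem_filter.1 hz
          exact Finset.mem_filter.2 ⟨hm z h1 b, (h z b h1).trans h2⟩)
      intro q hq
      rw [← this] at hq
      exact (Finset.mem_filter.1 hq).2
  set q₀ := m b₀ q₁ with hq₀
  have hq₀P : q₀ ∈ P := hm _ hq₁ _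
  have hq01 : q₀ ≠ q₁ := ne _ hq₁ _
  have hinv₀ : m b₀ q₀ = q₁ := inv _ hq₁ _
  -- the cycle with the edge `{q₀, q₁}` removed is a path
  set adj : Y → Y → Prop := fun x y => x ∈ P ∧ y ∈ P ∧ (∃ b, y = m b x) ∧
    ¬ (x = q₀ ∧ y = q₁) ∧ ¬ (x = q₁ ∧ y = q₀) with hadj
  have hsymm : ∀ x y, adj x y → adj y x := by
    rintro x y ⟨hx, hy, ⟨b, rfl⟩, h1, h2⟩
    exact ⟨hy, hx, ⟨b, (inv x hx b).symm⟩, fun h => h2 ⟨h.2, h.1⟩, fun h => h1 ⟨h.2, h.1⟩⟩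
  have hirr : ∀ x, ¬ adj x x := by
    rintro x ⟨hx, -, ⟨b, hb⟩, -⟩
    exact ne x hx b hb.symm
  obtain ⟨d, hd⟩ := exists_rank P adj hsymm q₁ hq₁ (by
    intro Z hZ h1 hcl
    have hcl' : ∀ z ∈ Z, ∀ b, ¬ (z = q₀ ∧ m b z = q₁) → ¬ (z = q₁ ∧ m b z = q₀) → m b z ∈ Z :=
      fun z hz b h2 h3 => hcl z hz _ (hm z (hZ hz) b) ⟨hZ hz, hm z (hZ hz) b, ⟨b, rfl⟩, h2, h3⟩
    have h0 : q₀ ∈ Z := by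
      by_contra h0
      have e1 : ∑ z ∈ Z, (1 : ZMod 2) = 0 := by
        refine Finset.sum_involution (fun z _ => m (!b₀) z) (fun _ _ => by decide)
          (fun z hz _ => ne z (hZ hz) _) (fun z hz => ?_) (fun z hz => inv z (hZ hz) _)
        refine hcl' z hz _ (fun h => h0 (h.1 ▸ hz)) ?_
        rintro ⟨rfl, h⟩
        exact ne' z hq₁ b₀ h.symm
      have e2 : ∑ z ∈ Z.erase q₁, (1 : ZMod 2) = 0 := by
        refine Finset.sum_involution (fun z _ => m b₀ z) (fun _ _ => by decide)
          (fun z hz _ => ne z (hZ (Finset.mem_of_mem_erase hz)) _) (fun z hz => ?_)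
          (fun z hz => inv z (hZ (Finset.mem_of_mem_erase hz)) _)
        obtain ⟨hz1, hz⟩ := Finset.mem_erase.1 hz
        refine Finset.mem_erase.2 ⟨fun h => h0 ?_,
          hcl' z hz _ (fun h => h0 (h.1 ▸ hz)) (fun h => hz1 h.1)⟩
        rw [hq₀, ← h, inv z (hZ hz)]
        exact hz
      rw [← Finset.add_sum_erase _ _ h1, e2] at e1
      exact absurd e1 (by decide)
    refine conn Z hZ ⟨_, h1⟩ fun z hz b => ?_
    by_cases h2 : z = q₀ ∧ m b z = q₁
    · exact h2.2 ▸ h1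
    · by_cases h3 : z = q₁ ∧ m b z = q₀
      · exact h3.2 ▸ h0
      · exact hcl' z hz b h2 h3)
  have hnbr : ∀ q ∈ P, q ≠ q₁ → ∃ b, adj q (m b q) ∧ d (m b q) < d q := by
    intro q hq hne
    obtain ⟨x, -, hx, hlt⟩ := hd q hq hne
    obtain ⟨b, rfl⟩ := hx.2.2.1
    exact ⟨b, hx, hlt⟩
  -- greedy coloring of the path
  have key : ∀ F' : Y → Finset (Fin 4), (∀ q ∈ P, q ≠ q₀ → (F' q).card = 2) →
      (F' q₀).card ≤ 3 → ∃ φ : Y → Fin 4, ∀ q ∈ P, φ q ∉ F' q ∧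
        ∀ x ∈ P, adj q x → φ q ≠ φ x := by
    intro F' h1 h2
    refine exists_greedy_coloring P adj hsymm hirr d F' fun q hq => ?_
    by_cases e0 : q = q₀
    · refine ⟨∅, fun x hx hqx hle => ?_, by rw [e0]; simpa using Nat.lt_succ_of_le h2⟩
      obtain ⟨b, hb, hlt⟩ := hnbr q hq (e0 ▸ hq01)
      obtain ⟨b', rfl⟩ := hqx.2.2.1
      have hb0 : b ≠ b₀ := by
        rintro rfl
        exact hb.2.2.2.1 ⟨e0, by rw [e0, hinv₀]⟩
      have hb0' : b' ≠ b₀ := by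
        rintro rfl
        exact hqx.2.2.2.1 ⟨e0, by rw [e0, hinv₀]⟩
      have : b' = b := by revert hb0 hb0'; cases b <;> cases b' <;> cases b₀ <;> simp
      subst this
      omega
    · by_cases e1 : q = q₁
      · refine ⟨{m (!b₀) q}, fun x hx hqx hle => ?_, by rw [h1 q hq e0]; simp⟩
        obtain ⟨b', rfl⟩ := hqx.2.2.1
        have hb0' : b' ≠ b₀ := by
          rintro rfl
          exact hqx.2.2.2.2 ⟨e1, by rw [e1]⟩
        have : b' = !b₀ := by revert hb0'; cases b' <;> cases b₀ <;> simp
        simp [this]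
      · obtain ⟨b, hb, hlt⟩ := hnbr q hq e1
        refine ⟨{m (!b) q}, fun x hx hqx hle => ?_, by rw [h1 q hq e0]; simp⟩
        obtain ⟨b', rfl⟩ := hqx.2.2.1
        have hb0' : b' ≠ b := by
          rintro rfl
          omega
        have : b' = !b := by revert hb0'; cases b' <;> cases b <;> simp
        simp [this]
  have finish : ∀ φ : Y → Fin 4, (∀ q ∈ P, φ q ∉ E q) →
      (∀ q ∈ P, ∀ x ∈ P, adj q x → φ q ≠ φ x) → φ q₀ ≠ φ q₁ →
      ∃ φ : Y → Fin 4, ∀ q ∈ P, φ q ∉ F q ∧ ∀ b, φ q ≠ φ (m b q) := by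
    intro φ h1 h2 h3
    refine ⟨φ, fun q hq => ⟨fun h => h1 q hq (hFE q hq h), fun b => ?_⟩⟩
    by_cases e0 : q = q₀ ∧ m b q = q₁
    · rw [e0.2, e0.1]; exact h3
    · by_cases e1 : q = q₁ ∧ m b q = q₀
      · rw [e1.2, e1.1]; exact h3.symm
      · exact h2 q hq _ (hm q hq b) ⟨hq, hm q hq b, ⟨b, rfl⟩, e0, e1⟩
  rcases hcase with hcase | hcase
  · obtain ⟨α, hα1, hα0⟩ : ∃ α, α ∈ E q₁ ∧ α ∉ E q₀ := by
      by_contra! hsub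
      exact hcase (Finset.eq_of_subset_of_card_le hsub (by rw [hE _ hq₀P, hE _ hq₁])).symm
    obtain ⟨φ, hφ⟩ := key (Function.update E q₀ {α}ᶜ)
      (fun q hq hne => by simp [hne, hE q hq]) (by simp [Finset.card_compl])
    have hφ0 : φ q₀ = α := by simpa using (hφ q₀ hq₀P).1
    have hφE : ∀ q ∈ P, φ q ∉ E q := by
      intro q hq
      by_cases e : q = q₀
      · rw [e, hφ0]; exact hα0
      · simpa [e] using (hφ q hq).1
    refine finish φ hφE (fun q hq => (hφ q hq).2) fun h => hφE q₁ hq₁ ?_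
    rw [← h, hφ0]; exact hα1
  · obtain ⟨φ, hφ⟩ := key E (fun q hq _ => hE q hq) (by rw [hE _ hq₀P]; norm_num)
    refine finish φ (fun q hq => (hφ q hq).1) (fun q hq => (hφ q hq).2) ?_
    obtain ⟨α, β, hαβ, hcompl⟩ : ∃ α β, α ≠ β ∧ (E q₁)ᶜ = {α, β} :=
      Finset.card_eq_two.1 (by simp [Finset.card_compl, hE _ hq₁])
    have hval : ∀ q ∈ P, φ q = α ∨ φ q = β := by
      intro q hq
      have : φ q ∈ (E q₁)ᶜ := by
        rw [← hcase q hq]; exact Finset.mem_compl.2 (hφ q hq).1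
      simpa [hcompl] using this
    set s : Y → ℤ := fun q => if φ q = α then 1 else -1 with hs
    have hs0 : ∀ q ∈ P, ∀ x ∈ P, φ q ≠ φ x → s q + s x = 0 := by
      intro q hq x hx hne
      simp only [hs]
      by_cases h1 : φ q = α
      · rw [if_pos h1, if_neg fun h2 => hne (h1.trans h2.symm)]; rfl
      · have h2 : φ x = α := (hval x hx).resolve_right fun h2 =>
          hne (((hval q hq).resolve_left h1).trans h2.symm)
        rw [if_neg h1, if_pos h2]; rfl
    have e1 : ∑ z ∈ P, s z = 0 := by
      refine Finset.sum_involution (fun z _ => m (!b₀) z) (fun z hz => ?_)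
        (fun z hz _ => ne z hz _) (fun z hz => hm z hz _) (fun z hz => inv z hz _)
      refine hs0 z hz _ (hm z hz _) ((hφ z hz).2 _ (hm z hz _) ⟨hz, hm z hz _, ⟨_, rfl⟩, ?_, ?_⟩)
      · exact fun h => ne' z hz b₀ (by rw [h.2, h.1, hinv₀])
      · exact fun h => ne' z hz b₀ (by rw [h.2, h.1])
    have e2 : ∑ z ∈ (P.erase q₀).erase q₁, s z = 0 := by
      have hPmem : ∀ z ∈ (P.erase q₀).erase q₁, z ≠ q₁ ∧ z ≠ q₀ ∧ z ∈ P := fun z hz => by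
        simpa using hz
      refine Finset.sum_involution (fun z _ => m b₀ z) (fun z hz => ?_)
        (fun z hz _ => ne z (hPmem z hz).2.2 _) (fun z hz => ?_)
        (fun z hz => inv z (hPmem z hz).2.2 _)
      · obtain ⟨h1, h0, hz⟩ := hPmem z hz
        exact hs0 z hz _ (hm z hz _) ((hφ z hz).2 _ (hm z hz _)
          ⟨hz, hm z hz _, ⟨_, rfl⟩, fun h => h0 h.1, fun h => h1 h.1⟩)
      · obtain ⟨h1, h0, hz⟩ := hPmem z hz
        simp only [Finset.mem_erase]
        refine ⟨fun h => h0 ?_, fun h => h1 ?_, hm z hz _⟩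
        · rw [hq₀, ← h, inv z hz]
        · rw [← hinv₀, ← h, inv z hz]
    rw [← Finset.add_sum_erase _ _ hq₀P,
      ← Finset.add_sum_erase _ _ (Finset.mem_erase.2 ⟨hq01.symm, hq₁⟩), e2] at e1
    intro h
    have : s q₀ = s q₁ := by simp only [hs, h]
    have h2 : s q₁ = 1 ∨ s q₁ = -1 := by
      simp only [hs]; split_ifs <;> simp
    omega

/-- A simple 3-regular bipartite graph presented on its set of edges: `s true` runs through the other
two edges at the first endpoint, `s false` through those at the second endpoint. -/
structure IsCubic {Y : Type*} (s : Bool → Bool → Y → Y) : Prop where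
  inv : ∀ b j p, s b (!j) (s b j p) = p
  sq : ∀ b j p, s b j (s b j p) = s b (!j) p
  ne : ∀ b j p, s b j p ≠ p
  cross : ∀ b j j' p, s b j p ≠ s (!b) j' p

section Combinatorics

variable {Y : Type*} {s : Bool → Bool → Y → Y} {S S' : Set Y} {p q r : Y}

lemma IsCubic.inv_not (hs : IsCubic s) (b j : Bool) (p : Y) : s b j (s b (!j) p) = p := by
  simpa using hs.inv b (!j) p

/-- The edge `p` is followed in `S` by `s b j p` across a vertex of degree two in `S`. -/
def Link (s : Bool → Bool → Y → Y) (S : Set Y) (p : Y) (b j : Bool) : Prop :=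
  p ∈ S ∧ s b j p ∈ S ∧ s b (!j) p ∉ S

/-- The `b`-endpoint of the edge `p` has degree three in `S`. -/
def Branch (s : Bool → Bool → Y → Y) (S : Set Y) (p : Y) (b : Bool) : Prop :=
  p ∈ S ∧ ∀ j, s b j p ∈ S

/-- Two edges of `S` lie on a common stretch of `S`, i.e. are connected across vertices of
degree two in `S`. -/
def Cls (s : Bool → Bool → Y → Y) (S : Set Y) : Y → Y → Prop :=
  Relation.ReflTransGen fun p q => ∃ b j, Link s S p b j ∧ q = s b j p

/-- The edges of `S` whose stretch ends in a vertex of degree three. -/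
def Live (s : Bool → Bool → Y → Y) (S : Set Y) : Set Y :=
  {p | p ∈ S ∧ ∃ q, Cls s S p q ∧ ∃ b, Branch s S q b}

lemma Live.subset : Live s S ⊆ S := fun _ h => h.1

lemma Link.symm (hs : IsCubic s) {b j : Bool} (h : Link s S p b j) :
    Link s S (s b j p) b (!j) := by
  refine ⟨h.2.1, by rw [hs.inv]; exact h.1, ?_⟩
  rw [Bool.not_not, hs.sq]
  exact h.2.2

lemma Cls.refl (p : Y) : Cls s S p p := Relation.ReflTransGen.refl

lemma Cls.trans (h : Cls s S p q) (h' : Cls s S q r) : Cls s S p r :=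
  Relation.ReflTransGen.trans h h'

lemma Cls.of_link {b j : Bool} (h : Link s S p b j) : Cls s S p (s b j p) :=
  Relation.ReflTransGen.single ⟨b, j, h, rfl⟩

lemma Cls.symm (hs : IsCubic s) (h : Cls s S p q) : Cls s S q p := by
  induction h with
  | refl => exact .refl p
  | tail _ h ih =>
    obtain ⟨b, j, hl, rfl⟩ := h
    have := Cls.of_link (hl.symm hs)
    rw [hs.inv] at this
    exact this.trans ih

lemma Cls.mem (h : Cls s S p q) (hp : p ∈ S) : q ∈ S := by
  induction h with
  | refl => exact hp
  | tail _ h _ =>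
    obtain ⟨b, j, hl, rfl⟩ := h
    exact hl.2.1

lemma Live.of_cls (hs : IsCubic s) (hp : p ∈ Live s S) (h : Cls s S p q) : q ∈ Live s S := by
  obtain ⟨hp, x, hx, b, hb⟩ := hp
  exact ⟨h.mem hp, x, (h.symm hs).trans hx, b, hb⟩

lemma Branch.live {b : Bool} (h : Branch s S p b) : p ∈ Live s S :=
  ⟨h.1, p, .refl p, b, h⟩

lemma Branch.step (hs : IsCubic s) {b : Bool} (h : Branch s S p b) (j : Bool) :
    Branch s S (s b j p) b := by
  refine ⟨h.2 j, fun i => ?_⟩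
  by_cases hi : i = j
  · rw [hi, hs.sq]; exact h.2 _
  · have : i = !j := by revert hi; cases i <;> cases j <;> simp
    rw [this, hs.inv]; exact h.1

lemma link_or_branch {b j : Bool} (hp : p ∈ S) (h : s b j p ∈ S) :
    Link s S p b j ∨ Branch s S p b := by
  by_cases h' : s b (!j) p ∈ S
  · refine Or.inr ⟨hp, fun i => ?_⟩
    by_cases hi : i = j
    · rwa [hi]
    · have : i = !j := by revert hi; cases i <;> cases j <;> simp
      rwa [this]
  · exact Or.inl ⟨hp, h, h'⟩

/-- A finite stretch has at most two ends. -/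
lemma exists_ends (hs : IsCubic s) (hfin : {q | Cls s S p q}.Finite) :
    ∃ I : Finset (Y × Bool), I.card ≤ 2 ∧
      ∀ q b, Cls s S p q → Branch s S q b → (q, b) ∈ I := by
  classical
  set P := hfin.toFinset with hP
  have hmemP : ∀ q, q ∈ P ↔ Cls s S p q := fun q => by simp [hP]
  set bd : Finset Y → Finset (Y × Bool) := fun T =>
    (T ×ˢ Finset.univ).filter fun x => ¬ ∃ j, Link s S x.1 x.2 j ∧ s x.2 j x.1 ∈ T with hbd
  have hmem : ∀ T x b, (x, b) ∈ bd T ↔ x ∈ T ∧ ¬ ∃ j, Link s S x b j ∧ s b j x ∈ T := by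
    intro T x b; simp [hbd]
  obtain ⟨T, hT, hmax⟩ := Finset.exists_max_image
    (P.powerset.filter fun T => p ∈ T ∧ (bd T).card ≤ 2) Finset.card
    ⟨{p}, by
      simp only [Finset.mem_filter, Finset.mem_powerset, Finset.singleton_subset_iff, hmemP,
        Finset.mem_singleton, true_and]
      refine ⟨.refl p, (Finset.card_filter_le _ _).trans (by simp)⟩⟩
  simp only [Finset.mem_filter, Finset.mem_powerset] at hT hmax
  obtain ⟨hTP, hpT, hcard⟩ := hT
  have hclosed : ∀ q ∈ T, ∀ b j, Link s S q b j → s b j q ∈ T := by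
    intro q hq b j hl
    by_contra hy
    have hsub : bd (insert (s b j q) T) ⊆ insert (s b j q, !b) ((bd T).erase (q, b)) := by
      rintro ⟨x, b'⟩ hx
      obtain ⟨hxT, hno⟩ := (hmem _ _ _).1 hx
      rcases Finset.mem_insert.1 hxT with rfl | hxT
      · refine Finset.mem_insert.2 (Or.inl ?_)
        by_cases hb : b' = b
        · subst hb
          exact (hno ⟨!j, hl.symm hs, by rw [hs.inv]; exact Finset.mem_insert_of_mem hq⟩).elim
        · have : b' = !b := by revert hb; cases b' <;> cases b <;> simp
          rw [this]
      · refine Finset.mem_insert_of_mem (Finset.mem_erase.2 ⟨?_, (hmem _ _ _).2 ⟨hxT, ?_⟩⟩)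
        · intro he
          obtain ⟨rfl, rfl⟩ := Prod.mk.inj he
          exact hno ⟨j, hl, Finset.mem_insert_self _ _⟩
        · rintro ⟨i, h1, h2⟩
          exact hno ⟨i, h1, Finset.mem_insert_of_mem h2⟩
    have hqb : (q, b) ∈ bd T := by
      refine (hmem _ _ _).2 ⟨hq, ?_⟩
      rintro ⟨i, h1, h2⟩
      by_cases hi : i = j
      · exact hy (hi ▸ h2)
      · have : i = !j := by revert hi; cases i <;> cases j <;> simp
        exact hl.2.2 (this ▸ h1.2.1)
    have h1 := Finset.card_le_card hsub
    have h2 := Finset.card_insert_le (s b j q, !b) ((bd T).erase (q, b))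
    rw [Finset.card_erase_of_mem hqb] at h2
    have h3 := Finset.card_pos.2 ⟨_, hqb⟩
    have h4 := hmax (insert (s b j q) T) ⟨Finset.insert_subset
      ((hmemP _).2 (((hmemP _).1 (hTP hq)).trans (.of_link hl))) hTP,
      Finset.mem_insert_of_mem hpT, by omega⟩
    rw [Finset.card_insert_of_notMem hy] at h4
    omega
  have hall : ∀ q, Cls s S p q → q ∈ T := by
    intro q hq
    induction hq with
    | refl => exact hpT
    | tail _ h ih =>
      obtain ⟨b, j, hl, rfl⟩ := h
      exact hclosed _ ih _ _ hl
  refine ⟨bd T, hcard, fun q b hq hb => (hmem _ _ _).2 ⟨hall q hq, ?_⟩⟩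
  rintro ⟨j, hl, -⟩
  exact hl.2.2 (hb.2 _)

/-- Three pairwise distinct ends of one stretch cannot exist. -/
lemma ends_unique (hs : IsCubic s) (hfin : {q | Cls s S p q}.Finite) {b c : Bool}
    (hq : Cls s S p q) (hbq : Branch s S q b) (hr : Cls s S p r) (hcr : Branch s S r c)
    (hne : (q, b) ≠ (r, c)) {x : Y} {d : Bool} (hx : Cls s S p x) (hdx : Branch s S x d) :
    (x, d) = (q, b) ∨ (x, d) = (r, c) := by
  classical
  obtain ⟨I, hI, hmem⟩ := exists_ends hs hfin
  by_contra! hcon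
  have hsub : ({(x, d), (q, b), (r, c)} : Finset (Y × Bool)) ⊆ I := by
    intro z hz
    simp only [Finset.mem_insert, Finset.mem_singleton] at hz
    rcases hz with rfl | rfl | rfl
    · exact hmem _ _ hx hdx
    · exact hmem _ _ hq hbq
    · exact hmem _ _ hr hcr
  have := Finset.card_le_card hsub
  rw [Finset.card_eq_three.2 ⟨_, _, _, hcon.1, hcon.2, hne, rfl⟩] at this
  omega

lemma cls_conn (hfin : {q | Cls s S p q}.Finite) (hs : IsCubic s) {q₀ : Y} (hq₀ : Cls s S p q₀)
    (Z : Finset Y) (hZ : Z ⊆ hfin.toFinset) (h0 : q₀ ∈ Z)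
    (h : ∀ z ∈ Z, ∀ b j, Link s S z b j → s b j z ∈ Z) : Z = hfin.toFinset := by
  refine subset_antisymm hZ fun x hx => ?_
  have hx : Cls s S q₀ x := (hq₀.symm hs).trans (by simpa using hx)
  induction hx with
  | refl => exact h0
  | tail hy hl ih =>
    obtain ⟨b, j, hl, rfl⟩ := hl
    refine h _ (ih ?_) _ _ hl
    simpa using hq₀.trans hy

/-- A coloring of everything off `S` extends to a live stretch whose neighbors at some end
remain uncolored. -/
lemma exists_stretch_coloring (hs : IsCubic s) (hfin : {q | Cls s S p q}.Finite)
    {q₀ : Y} {b₀ : Bool}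
    (hq₀ : Cls s S p q₀) (hb₀ : Branch s S q₀ b₀) (hout : ∀ j, ¬ Cls s S p (s b₀ j q₀))
    (c : Y → Fin 4) :
    ∃ φ : Y → Fin 4, ∀ q, Cls s S p q → ∀ b j,
      (s b j q ∉ S → φ q ≠ c (s b j q)) ∧ (Cls s S p (s b j q) → φ q ≠ φ (s b j q)) := by
  classical
  have hmemP : ∀ q, q ∈ hfin.toFinset ↔ Cls s S p q := fun q => by simp
  have hpS : ∀ q, Cls s S p q → q ∈ S := fun q hq => ((hq₀.symm hs).trans hq).mem hb₀.1
  set adj : Y → Y → Prop := fun x y => ∃ b j, y = s b j x with hadj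
  have hsymm : ∀ x y, adj x y → adj y x := by
    rintro x _ ⟨b, j, rfl⟩
    exact ⟨b, !j, (hs.inv _ _ _).symm⟩
  obtain ⟨d, hd⟩ := exists_rank hfin.toFinset adj hsymm q₀ ((hmemP _).2 hq₀)
    fun Z hZ h0 h => cls_conn hfin hs hq₀ Z hZ h0 fun z hz b j hl =>
      h z hz _ ((hmemP _).2 (((hmemP _).1 (hZ hz)).trans (.of_link hl))) ⟨b, j, rfl⟩
  set A : Y → Finset (Bool × Bool) := fun q => Finset.univ.filter fun l => s l.1 l.2 q ∉ S with hA
  set B : Y → Finset (Bool × Bool) := fun q => Finset.univ.filter fun l =>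
    Cls s S p (s l.1 l.2 q) ∧ d q ≤ d (s l.1 l.2 q) with hB
  obtain ⟨φ, hφ⟩ := exists_greedy_coloring hfin.toFinset adj hsymm
    (by rintro x ⟨b, j, h⟩; exact hs.ne _ _ _ h.symm) d
    (fun q => (A q).image fun l => c (s l.1 l.2 q)) fun q hq => by
      refine ⟨(B q).image fun l => s l.1 l.2 q, ?_, ?_⟩
      · rintro _ hx ⟨b, j, rfl⟩ hle
        exact Finset.mem_image.2 ⟨(b, j), by simpa [hB] using ⟨(hmemP _).1 hx, hle⟩, rfl⟩
      · have h1 : ((A q).image fun l => c (s l.1 l.2 q)).card ≤ _ := Finset.card_image_le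
        have h2 : ((B q).image fun l => s l.1 l.2 q).card ≤ _ := Finset.card_image_le
        have h3 : Disjoint (A q) (B q) := by
          rw [Finset.disjoint_left]
          intro l hl hl'
          simp only [hA, hB, Finset.mem_filter, Finset.mem_univ, true_and] at hl hl'
          exact hl (hpS _ hl'.1)
        have h4 : ∃ l, l ∉ A q ∪ B q := by
          by_cases he : q = q₀
          · subst he
            refine ⟨(b₀, true), ?_⟩
            simp only [hA, hB, Finset.mem_union, Finset.mem_filter, Finset.mem_univ, true_and]
            rintro (h | h)
            · exact h (hb₀.2 _)
            · exact hout _ h.1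
          · obtain ⟨_, hx, ⟨b, j, rfl⟩, hlt⟩ := hd q hq he
            refine ⟨(b, j), ?_⟩
            simp only [hA, hB, Finset.mem_union, Finset.mem_filter, Finset.mem_univ, true_and]
            rintro (h | h)
            · exact h (hpS _ ((hmemP _).1 hx))
            · omega
        obtain ⟨l, hl⟩ := h4
        have h5 : (A q ∪ B q).card < Fintype.card (Bool × Bool) :=
          Finset.card_lt_univ_of_notMem hl
        rw [Finset.card_union_of_disjoint h3] at h5
        simp only [Fintype.card_prod, Fintype.card_bool] at h5
        omega
  refine ⟨φ, fun q hq b j => ⟨fun h he => ?_, fun h => ?_⟩⟩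
  · refine (hφ q ((hmemP _).2 hq)).1 (Finset.mem_image.2 ⟨(b, j), by simpa [hA] using h, he.symm⟩)
  · exact (hφ q ((hmemP _).2 hq)).2 _ ((hmemP _).2 h) ⟨b, j, rfl⟩

/-- A coloring of everything off `S` extends to a stretch that closes up to a cycle. -/
lemma exists_closed_stretch_coloring (hs : IsCubic s) (hp : p ∈ S)
    (hfin : {q | Cls s S p q}.Finite)
    (hreg : ∀ q, Cls s S p q → ∀ b, (∃ j, s b j q ∈ S) ∧ ¬ Branch s S q b) (c : Y → Fin 4) :
    ∃ φ : Y → Fin 4, ∀ q, Cls s S p q → ∀ b j,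
      (s b j q ∉ S → φ q ≠ c (s b j q)) ∧ (Cls s S p (s b j q) → φ q ≠ φ (s b j q)) := by
  classical
  have hmemP : ∀ q, q ∈ hfin.toFinset ↔ Cls s S p q := fun q => by simp
  set i : Bool → Y → Bool := fun b q => ! decide (s b false q ∈ S) with hi
  have hlink : ∀ q, Cls s S p q → ∀ b, Link s S q b (i b q) := by
    intro q hq b
    obtain ⟨⟨j, hj⟩, hnb⟩ := hreg q hq b
    have hij : s b (i b q) q ∈ S := by
      by_cases h : s b false q ∈ S
      · simp [hi, h]
      · cases j
        · exact (h hj).elim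
        · simpa [hi, h] using hj
    exact (link_or_branch (hq.mem hp) hij).resolve_right hnb
  have hiuniq : ∀ q, Cls s S p q → ∀ b j, s b j q ∈ S → j = i b q := by
    intro q hq b j hj
    by_contra hne
    have : j = ! i b q := by revert hne; cases j <;> cases i b q <;> simp
    exact (hlink q hq b).2.2 (this ▸ hj)
  set m : Bool → Y → Y := fun b q => s b (i b q) q with hm
  have hmcls : ∀ q, Cls s S p q → ∀ b, Cls s S p (m b q) := fun q hq b =>
    hq.trans (.of_link (hlink q hq b))
  obtain ⟨φ, hφ⟩ := exists_cycle_coloring hfin.toFinset m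
    (fun q hq b => (hmemP _).2 (hmcls q ((hmemP _).1 hq) b))
    (fun q hq b => by
      have hq := (hmemP _).1 hq
      have h1 := hiuniq _ (hmcls q hq b) b (! i b q) (by
        simp only [hm, hs.inv]; exact hq.mem hp)
      change s b (i b (m b q)) (m b q) = q
      rw [← h1]
      exact hs.inv _ _ _)
    (fun q _ b => hs.ne _ _ _)
    (fun q _ b => hs.cross _ _ _ _)
    (fun Z hZ hne hcl => by
      obtain ⟨z, hz⟩ := hne
      refine cls_conn hfin hs ((hmemP _).1 (hZ hz)) Z hZ hz fun x hx b j hl => ?_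
      rw [hiuniq x ((hmemP _).1 (hZ hx)) b j hl.2.1]
      exact hcl x hx b)
    (fun q => (Finset.univ.image fun b => (b, ! i b q)).image fun l => c (s l.1 l.2 q))
    (fun q _ => Finset.card_image_le.trans (Finset.card_image_le.trans (by simp)))
  refine ⟨φ, fun q hq b j => ⟨fun h he => ?_, fun h => ?_⟩⟩
  · refine (hφ q ((hmemP _).2 hq)).1 ?_
    have : j = ! i b q := by
      have hne : j ≠ i b q := fun e => h (e ▸ (hlink q hq b).2.1)
      revert hne; cases j <;> cases i b q <;> simp
    rw [he, this]
    exact Finset.mem_image.2 ⟨(b, ! i b q), Finset.mem_image.2 ⟨b, Finset.mem_univ _, rfl⟩, rfl⟩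
  · have := (hφ q ((hmemP _).2 hq)).2 b
    rwa [hiuniq q hq b j (h.mem hp)]

end Combinatorics

section Borel

variable {Y : Type*} {s : Bool → Bool → Y → Y} {S T : Set Y}

/-- The action of words in the step maps. -/
def act (s : Bool → Bool → Y → Y) : List (Bool × Bool) → Y → Y
  | [], p => p
  | l :: w, p => act s w (s l.1 l.2 p)

lemma act_append (w w' : List (Bool × Bool)) (p : Y) :
    act s (w ++ w') p = act s w' (act s w p) := by
  induction w generalizing p with
  | nil => rfl
  | cons l w ih => exact ih _

variable [MeasurableSpace Y]

lemma measurable_act (hm : ∀ b j, Measurable (s b j)) (w : List (Bool × Bool)) :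
    Measurable (act s w) := by
  induction w with
  | nil => exact measurable_id
  | cons l w ih => exact ih.comp (hm _ _)

/-- A Borel relation contained in the connectedness relation of the step maps. -/
structure BRel (s : Bool → Bool → Y → Y) (Q : Y → Y → Prop) : Prop where
  loc : ∀ p q, Q p q → ∃ w, act s w p = q
  meas : MeasurableSet {z : Y × Y | Q z.1 z.2}

lemma BRel.exists_meas {Q : Y → Y → Prop} (hQ : BRel s Q) (hm : ∀ b j, Measurable (s b j))
    {Z : Type*} [MeasurableSpace Z] {f : Z → Y} (hf : Measurable f) {R : Z → Y → Prop}
    (hR : MeasurableSet {x : Z × Y | R x.1 x.2}) :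
    MeasurableSet {z | ∃ q, Q (f z) q ∧ R z q} := by
  have : {z | ∃ q, Q (f z) q ∧ R z q} =
      ⋃ w : List (Bool × Bool), {z | Q (f z) (act s w (f z)) ∧ R z (act s w (f z))} := by
    ext z
    simp only [Set.mem_ofPred_eq, Set.mem_iUnion]
    constructor
    · rintro ⟨q, h, h'⟩
      obtain ⟨w, rfl⟩ := hQ.loc _ _ h
      exact ⟨w, h, h'⟩
    · rintro ⟨w, h, h'⟩
      exact ⟨_, h, h'⟩
  rw [this]
  refine .iUnion fun w => ?_
  have hw := (measurable_act hm w).comp hf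
  exact (hQ.meas.preimage (hf.prodMk hw)).inter (hR.preimage (measurable_id.prodMk hw))

lemma BRel.comp {Q R : Y → Y → Prop} (hQ : BRel s Q) (hR : BRel s R)
    (hm : ∀ b j, Measurable (s b j)) : BRel s fun p q => ∃ r, Q p r ∧ R r q := by
  refine ⟨?_, ?_⟩
  · rintro p q ⟨r, h, h'⟩
    obtain ⟨w, rfl⟩ := hQ.loc _ _ h
    obtain ⟨w', rfl⟩ := hR.loc _ _ h'
    exact ⟨w ++ w', act_append _ _ _⟩
  · exact hQ.exists_meas hm (Z := Y × Y) measurable_fst (R := fun z r => R r z.2)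
      (hR.meas.preimage (measurable_snd.prodMk (measurable_snd.comp measurable_fst)))

lemma BRel.iUnion {ι : Type*} [Countable ι] {Q : ι → Y → Y → Prop} (hQ : ∀ i, BRel s (Q i)) :
    BRel s fun p q => ∃ i, Q i p q := by
  refine ⟨fun p q ⟨i, h⟩ => (hQ i).loc _ _ h, ?_⟩
  simp only [Set.ofPred_exists]
  exact .iUnion fun i => (hQ i).meas

lemma BRel.or {Q R : Y → Y → Prop} (hQ : BRel s Q) (hR : BRel s R) :
    BRel s fun p q => Q p q ∨ R p q :=
  ⟨fun p q h => h.elim (hQ.loc p q) (hR.loc p q), hQ.meas.union hR.meas⟩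

lemma BRel.and {Q R : Y → Y → Prop} (hQ : BRel s Q)
    (hR : MeasurableSet {z : Y × Y | R z.1 z.2}) : BRel s fun p q => Q p q ∧ R p q :=
  ⟨fun p q h => hQ.loc p q h.1, hQ.meas.inter hR⟩

lemma measurableSet_branch (hm : ∀ b j, Measurable (s b j)) (hS : MeasurableSet S) (b : Bool) :
    MeasurableSet {p | Branch s S p b} := by
  simp only [Branch, Set.ofPred_and, Set.ofPred_forall]
  exact hS.inter (.iInter fun j => hm b j hS)

variable [StandardBorelSpace Y]

lemma BRel.eq : BRel s fun p q => q = p :=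
  ⟨fun _ _ h => ⟨[], h.symm⟩, measurableSet_eq_fun measurable_snd measurable_fst⟩

lemma BRel.step (hm : ∀ b j, Measurable (s b j)) (b j : Bool) : BRel s fun p q => q = s b j p :=
  ⟨fun _ _ h => ⟨[(b, j)], h.symm⟩,
    measurableSet_eq_fun measurable_snd ((hm b j).comp measurable_fst)⟩

lemma BRel.reflTransGen {Q : Y → Y → Prop} (hQ : BRel s Q) (hm : ∀ b j, Measurable (s b j)) :
    BRel s (Relation.ReflTransGen Q) := by
  let C : ℕ → Y → Y → Prop := fun n =>
    n.rec (fun p q => q = p) fun _ R p q => ∃ r, R p r ∧ Q r q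
  have hC : ∀ n, BRel s (C n) := by
    intro n
    induction n with
    | zero => exact BRel.eq
    | succ n ih => exact ih.comp hQ hm
  have : Relation.ReflTransGen Q = fun p q => ∃ n, C n p q := by
    funext p q
    refine propext ⟨fun h => ?_, ?_⟩
    · induction h with
      | refl => exact ⟨0, rfl⟩
      | tail _ h ih =>
        obtain ⟨n, hn⟩ := ih
        exact ⟨n + 1, _, hn, h⟩
    · rintro ⟨n, hn⟩
      induction n generalizing q with
      | zero => rw [show q = p from hn]
      | succ n ih =>
        obtain ⟨r, hr, hq⟩ := hn
        exact (ih r hr).tail hq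
  rw [this]
  exact BRel.iUnion hC

lemma BRel.cls (hm : ∀ b j, Measurable (s b j)) (hS : MeasurableSet S) : BRel s (Cls s S) := by
  refine BRel.reflTransGen (BRel.iUnion fun b => BRel.iUnion fun j => ?_) hm
  have := (BRel.step hm b j).and (R := fun p _ => Link s S p b j) (by
    have : MeasurableSet {p | Link s S p b j} :=
      hS.inter ((hm b j hS).inter (hm b (!j) hS.compl))
    exact this.preimage measurable_fst)
  exact ⟨fun p q h => this.loc p q h.symm, by simpa only [and_comm] using this.meas⟩

lemma measurableSet_live (hm : ∀ b j, Measurable (s b j)) (hS : MeasurableSet S) :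
    MeasurableSet (Live s S) := by
  refine hS.inter ((BRel.cls hm hS).exists_meas hm measurable_id
    (R := fun _ q => ∃ b, Branch s S q b) ?_)
  simp only [Set.ofPred_exists]
  exact .iUnion fun b => (measurableSet_branch hm hS b).preimage measurable_snd

/-- There is a countable family of Borel functions interpolating on all finite sets. -/
lemma exists_interpolating (Y : Type*) [MeasurableSpace Y] [StandardBorelSpace Y] (C : Type*)
    [Finite C] [Nonempty C] [MeasurableSpace C] :
    ∃ h : ℕ → Y → C, (∀ j, Measurable (h j)) ∧
      ∀ F : Set Y, F.Finite → ∀ φ : Y → C, ∃ j, ∀ p ∈ F, h j p = φ p := by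
  classical
  obtain ⟨i, hi, hinj⟩ := MeasurableSpace.measurable_injection_nat_bool_of_countablySeparated Y
  obtain ⟨e, he⟩ := exists_surjective_nat (Σ n : ℕ, (Fin n → Bool) → C)
  refine ⟨fun j p => (e j).2 fun k => i p k, fun j => ?_, fun F hF φ => ?_⟩
  · exact (measurable_of_countable _).comp
      (measurable_pi_lambda _ fun k => (measurable_pi_apply _).comp hi)
  · have hk : ∀ p q : Y, ∃ k, p ≠ q → i p k ≠ i q k := by
      intro p q
      by_cases h : p = q
      · exact ⟨0, fun h' => (h' h).elim⟩
      · by_contra! hcon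
        exact h (hinj (funext fun k => (hcon k).2))
    choose k hk using hk
    obtain ⟨n, hn⟩ := ((hF.prod hF).image fun z => k z.1 z.2).bddAbove
    have hsep : ∀ p ∈ F, ∀ q ∈ F, (∀ m : Fin (n + 1), i p m = i q m) → p = q := by
      intro p hp q hq h
      by_contra hne
      have : k p q ≤ n := hn ⟨(p, q), ⟨hp, hq⟩, rfl⟩
      exact hk p q hne (h ⟨k p q, by omega⟩)
    obtain ⟨j, hj⟩ := he ⟨n + 1, fun x =>
      if h : ∃ p ∈ F, ∀ m : Fin (n + 1), i p m = x m then φ h.choose else Classical.arbitrary C⟩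
    refine ⟨j, fun p hp => ?_⟩
    beta_reduce
    rw [hj]
    have h : ∃ q ∈ F, ∀ m : Fin (n + 1), i q m = i p m := ⟨p, hp, fun _ => rfl⟩
    simp only [dif_pos h]
    rw [hsep _ h.choose_spec.1 p hp h.choose_spec.2]

/-- Extensions of a coloring to the individual stretches in `T` can be chosen in a Borel way. -/
lemma exists_extension (hs : IsCubic s) (hm : ∀ b j, Measurable (s b j)) (hS : MeasurableSet S)
    (hT : MeasurableSet T) (hTS : T ⊆ S) (hinv : ∀ p ∈ T, ∀ q, Cls s S p q → q ∈ T)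
    (hfin : ∀ p ∈ T, {q | Cls s S p q}.Finite)
    (hadj : ∀ p ∈ T, ∀ b j, s b j p ∈ T → Cls s S p (s b j p))
    {c : Y → Fin 4} (hc : Measurable c)
    (hcp : ∀ p b j, p ∉ S → s b j p ∉ S → c p ≠ c (s b j p))
    (hφ : ∀ p ∈ T, ∃ φ : Y → Fin 4, ∀ q, Cls s S p q → ∀ b j,
      (s b j q ∉ S → φ q ≠ c (s b j q)) ∧ (Cls s S p (s b j q) → φ q ≠ φ (s b j q))) :
    ∃ c' : Y → Fin 4, Measurable c' ∧ (∀ p ∉ T, c' p = c p) ∧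
      ∀ p b j, (p ∉ S ∨ p ∈ T) → (s b j p ∉ S ∨ s b j p ∈ T) → c' p ≠ c' (s b j p) := by
  classical
  obtain ⟨h, hh, hint⟩ := exists_interpolating Y (Fin 4)
  have hcls := BRel.cls hm hS
  set V : ℕ → Y → Prop := fun i p => ∀ q, Cls s S p q → ∀ b j,
      (s b j q ∉ S → h i q ≠ c (s b j q)) ∧ (Cls s S p (s b j q) → h i q ≠ h i (s b j q)) with hV
  have hVm : ∀ i, MeasurableSet {p | V i p} := by
    intro i
    have := hcls.exists_meas hm measurable_id (R := fun p q => ∃ b j,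
      (s b j q ∉ S ∧ h i q = c (s b j q)) ∨ (Cls s S p (s b j q) ∧ h i q = h i (s b j q))) (by
        simp only [Set.ofPred_exists]
        refine .iUnion fun b => .iUnion fun j => ?_
        have hsj := (hm b j).comp (measurable_snd : Measurable (Prod.snd : Y × Y → Y))
        refine (MeasurableSet.inter (hS.compl.preimage hsj) ?_).union (.inter ?_ ?_)
        · exact measurableSet_eq_fun ((hh i).comp measurable_snd) (hc.comp hsj)
        · exact hcls.meas.preimage (measurable_fst.prodMk hsj)
        · exact measurableSet_eq_fun ((hh i).comp measurable_snd) ((hh i).comp hsj))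
    convert this.compl using 1
    ext p
    simp only [hV, Set.mem_ofPred_eq, Set.mem_compl_iff, id]
    push Not
    rfl
  have hex : ∀ p, ∃ i, V i p ∨ p ∉ T := by
    intro p
    by_cases hp : p ∈ T
    · obtain ⟨φ, hφ⟩ := hφ p hp
      obtain ⟨i, hi⟩ := hint _ (hfin p hp) φ
      refine ⟨i, Or.inl fun q hq b j => ?_⟩
      rw [hi q hq]
      refine ⟨(hφ q hq b j).1, fun hq' => ?_⟩
      rw [hi _ hq']
      exact (hφ q hq b j).2 hq'
    · exact ⟨0, Or.inr hp⟩
  set J : Y → ℕ := fun p => Nat.find (hex p) with hJ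
  have hJm : Measurable J := measurable_find hex fun i => (hVm i).union hT.compl
  have hJV : ∀ p ∈ T, V (J p) p := fun p hp => (Nat.find_spec (hex p)).resolve_right (not_not.2 hp)
  have hiff : ∀ p q, Cls s S p q → p ∈ T → ∀ i, (V i p ∨ p ∉ T) → (V i q ∨ q ∉ T) := by
    intro p q hpq hp i hi
    refine Or.inl fun x hx b j => ?_
    have := (hi.resolve_right (not_not.2 hp)) x (hpq.trans hx) b j
    exact ⟨this.1, fun hx' => this.2 (hpq.trans hx')⟩
  have hJle : ∀ p q, Cls s S p q → p ∈ T → J q ≤ J p := fun p q hpq hp =>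
    Nat.find_min' _ (hiff p q hpq hp _ (Nat.find_spec (hex p)))
  have hJeq : ∀ p q, Cls s S p q → p ∈ T → J p = J q := fun p q hpq hp =>
    le_antisymm (hJle q p (hpq.symm hs) (hinv p hp q hpq)) (hJle p q hpq hp)
  have hhJ : Measurable fun p => h (J p) p :=
    (measurable_from_prod_countable_right (f := fun z : ℕ × Y => h z.1 z.2) hh).comp
      (hJm.prodMk measurable_id)
  refine ⟨fun p => if p ∈ T then h (J p) p else c p, hhJ.ite hT hc, fun p hp => if_neg hp, ?_⟩
  have key : ∀ p b j, p ∈ T → s b j p ∉ S → h (J p) p ≠ c (s b j p) := fun p b j hp hq =>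
    (hJV p hp p (.refl p) b j).1 hq
  intro p b j hp hq
  beta_reduce
  rcases hp with hp | hp <;> rcases hq with hq | hq
  · rw [if_neg fun h => hp (hTS h), if_neg fun h => hq (hTS h)]
    exact hcp p b j hp hq
  · rw [if_neg fun h => hp (hTS h), if_pos hq]
    have := key _ b (!j) hq (by rwa [hs.inv])
    rw [hs.inv] at this
    exact this.symm
  · rw [if_pos hp, if_neg fun h => hq (hTS h)]
    exact key p b j hp hq
  · have hcl := hadj p hp b j hq
    rw [if_pos hp, if_pos hq, ← hJeq _ _ hcl hp]
    exact (hJV p hp p (.refl p) b j).2 hcl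

end Borel

section Greedy

variable {Y : Type*} {s : Bool → Bool → Y → Y} [MeasurableSpace Y] [StandardBorelSpace Y]

/-- A Borel graph on the classes of a finite Borel equivalence relation, of degree at most `K`,
has a Borel coloring with `K + 1` colors. -/
lemma exists_class_coloring (hm : ∀ b j, Measurable (s b j)) {E D : Y → Y → Prop}
    (hE : BRel s E) (hD : BRel s D) (hEq : Equivalence E) (hDs : ∀ p q, D p q → D q p)
    (hDi : ∀ p p' q, E p p' → D p q → D p' q) (hDE : ∀ p q, D p q → ¬ E p q)
    (hEf : ∀ p, {q | E p q}.Finite) (hDf : ∀ p, {q | D p q}.Finite) (K : ℕ)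
    (hK : ∀ p, ∃ T : Finset Y, T.card ≤ K ∧ ∀ q, D p q → ∃ t ∈ T, E t q) :
    ∃ col : Y → ℕ, Measurable col ∧ (∀ p, col p ≤ K) ∧ (∀ p q, E p q → col p = col q) ∧
      ∀ p q, D p q → col p ≠ col q := by
  classical
  obtain ⟨h, hh, hint⟩ := exists_interpolating Y Bool
  set V : ℕ → Y → Prop := fun i p =>
    (∀ q, E p q → h i q = true) ∧ ∀ q, D p q → h i q = false with hV
  have hVm : ∀ i, MeasurableSet {p | V i p} := by
    intro i
    have h1 := hE.exists_meas hm measurable_id (R := fun _ q => h i q = false)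
      ((hh i).comp measurable_snd (measurableSet_singleton _))
    have h2 := hD.exists_meas hm measurable_id (R := fun _ q => h i q = true)
      ((hh i).comp measurable_snd (measurableSet_singleton _))
    convert h1.compl.inter h2.compl using 1
    ext p
    simp [hV]
  have hex : ∀ p, ∃ i, V i p := by
    intro p
    obtain ⟨i, hi⟩ := hint _ ((hEf p).union (hDf p)) fun q => decide (E p q)
    refine ⟨i, fun q hq => ?_, fun q hq => ?_⟩
    · rw [hi q (Or.inl hq)]; simpa using hq
    · rw [hi q (Or.inr hq)]; simpa using hDE p q hq
  set c : Y → ℕ := fun p => Nat.find (hex p) with hc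
  have hcm : Measurable c := measurable_find hex hVm
  have hVi : ∀ p q, E p q → ∀ i, V i p → V i q := fun p q hpq i hi =>
    ⟨fun x hx => hi.1 x (hEq.trans hpq hx), fun x hx => hi.2 x (hDi _ _ _ (hEq.symm hpq) hx)⟩
  have hcle : ∀ p q, E p q → c q ≤ c p := fun p q hpq =>
    Nat.find_min' _ (hVi p q hpq _ (Nat.find_spec (hex p)))
  have hcE : ∀ p q, E p q → c p = c q := fun p q hpq =>
    le_antisymm (hcle _ _ (hEq.symm hpq)) (hcle _ _ hpq)
  have hcD : ∀ p q, D p q → c p ≠ c q := by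
    intro p q hpq he
    have h1 := (Nat.find_spec (hex p)).1 p (hEq.refl p)
    have h2 := (Nat.find_spec (hex q)).2 p (hDs _ _ hpq)
    change h (c p) p = true at h1
    change h (c q) p = false at h2
    rw [he, h2] at h1
    exact absurd h1 (by simp)
  let used : (Y → ℕ) → ℕ → Y → ℕ → Prop := fun F n p k => ∃ q, D p q ∧ (c q < n ∧ F q = k)
  have hused : ∀ F n p, ∃ k, ¬ used F n p k ∨ k = K := fun F n p => ⟨K, Or.inr rfl⟩
  let G : (Y → ℕ) → ℕ → Y → ℕ := fun F n p => Nat.find (hused F n p)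
  have hGs : ∀ F n p, ¬ used F n p (G F n p) ∨ G F n p = K := fun F n p =>
    Nat.find_spec (hused F n p)
  have hGm : ∀ F n p k, (¬ used F n p k ∨ k = K) → G F n p ≤ k := fun F n p k hk =>
    Nat.find_min' (hused F n p) hk
  let F : ℕ → Y → ℕ := fun n => n.rec (fun _ => 0) fun n F p => if c p = n then G F n p else F p
  have hF1 : ∀ n p, F (n + 1) p = if c p = n then G (F n) n p else F n p := fun n p => rfl
  have hFm : ∀ n, Measurable (F n) := by
    intro n
    induction n with
    | zero => exact measurable_const
    | succ n ih =>
      refine Measurable.ite (hcm (measurableSet_singleton n)) (measurable_find _ fun k => ?_) ih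
      refine MeasurableSet.union (MeasurableSet.compl ?_) (.const _)
      exact hD.exists_meas hm measurable_id (R := fun _ q => c q < n ∧ F n q = k)
        ((measurable_snd (hcm (measurableSet_Iio (a := n)))).inter
          (measurable_snd (ih (measurableSet_singleton k))))
  have hFE : ∀ n p q, E p q → F n p = F n q := by
    intro n
    induction n with
    | zero => intros; rfl
    | succ n ih =>
      intro p q hpq
      rw [hF1, hF1, hcE p q hpq, ih p q hpq]
      congr 1
      have : used (F n) n p = used (F n) n q := by
        funext k
        refine propext ⟨?_, ?_⟩
        · rintro ⟨x, hx, h⟩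
          exact ⟨x, hDi _ _ _ hpq hx, h⟩
        · rintro ⟨x, hx, h⟩
          exact ⟨x, hDi _ _ _ (hEq.symm hpq) hx, h⟩
      have hle : ∀ p q, used (F n) n p = used (F n) n q → G (F n) n p ≤ G (F n) n q := by
        intro p q h
        have h1 : ¬ used (F n) n p (G (F n) n q) ∨ G (F n) n q = K := by
          rw [h]
          exact hGs (F n) n q
        exact hGm _ _ _ _ h1
      exact le_antisymm (hle _ _ this) (hle _ _ this.symm)
  have hFle : ∀ n p, F n p ≤ K := by
    intro n
    induction n with
    | zero => intro p; exact Nat.zero_le _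
    | succ n ih =>
      intro p
      rw [hF1]
      split_ifs
      · exact hGm _ _ _ _ (Or.inr rfl)
      · exact ih p
  have hG : ∀ n p, ¬ used (F n) n p (G (F n) n p) := by
    intro n p
    rcases hGs (F n) n p with h | h
    · exact h
    · obtain ⟨T, hT, hcov⟩ := hK p
      obtain ⟨k, hk, hkT⟩ : ∃ k ∈ Finset.range (K + 1), k ∉ T.image (F n) :=
        Finset.exists_mem_notMem_of_card_lt_card
          (lt_of_le_of_lt (Finset.card_image_le.trans hT) (by simp))
      have hku : ¬ used (F n) n p k := by
        rintro ⟨q, hq, -, rfl⟩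
        obtain ⟨t, ht, htq⟩ := hcov q hq
        exact hkT (Finset.mem_image.2 ⟨t, ht, hFE n _ _ htq⟩)
      have h1 : G (F n) n p ≤ k := hGm _ _ _ _ (Or.inl hku)
      have h2 : G (F n) n p = K := h
      have h3 := Finset.mem_range.1 hk
      rwa [show G (F n) n p = k by omega]
  have hstab : ∀ p n, F (c p + 1 + n) p = F (c p + 1) p := by
    intro p n
    induction n with
    | zero => rfl
    | succ n ih => rw [← ih, ← add_assoc, hF1, if_neg (by omega)]
  refine ⟨fun p => F (c p + 1) p, ?_, fun p => hFle (c p + 1) p, fun p q hpq => ?_, ?_⟩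
  · exact (measurable_from_prod_countable_right (f := fun z : ℕ × Y => F (z.1 + 1) z.2)
      fun n => hFm (n + 1)).comp (hcm.prodMk measurable_id)
  · beta_reduce
    rw [hcE p q hpq]
    exact hFE (c q + 1) p q hpq
  · have key : ∀ p q, D p q → c q < c p → F (c p + 1) p ≠ F (c q + 1) q := by
      intro p q hpq hlt he
      rw [hF1, if_pos rfl] at he
      refine hG (c p) p ⟨q, hpq, hlt, ?_⟩
      rw [he, ← hstab q (c p - (c q + 1))]
      congr 1
      omega
    intro p q hpq
    rcases lt_or_gt_of_ne (hcD p q hpq) with h | h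
    · exact (key q p (hDs _ _ hpq) h).symm
    · exact key p q hpq h

end Greedy

section Near

variable {Y : Type*} {s : Bool → Bool → Y → Y} {S R : Set Y} {p q r : Y}

/-- The sets of edges occurring in the construction: no vertex has degree one, and all stretches
are finite. -/
structure Good (s : Bool → Bool → Y → Y) (S : Set Y) : Prop where
  deg : ∀ p ∈ S, ∀ b, ∃ j, s b j p ∈ S
  fin : ∀ p, {q | Cls s S p q}.Finite

/-- Two edges of `S` are equal or intersect. -/
def St (s : Bool → Bool → Y → Y) (S : Set Y) (p q : Y) : Prop :=
  (q = p ∨ ∃ b j, q = s b j p) ∧ p ∈ S ∧ q ∈ S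

/-- The stretch of `p` meets `q`. -/
def ClsSt (s : Bool → Bool → Y → Y) (S : Set Y) (p q : Y) : Prop :=
  ∃ r, Cls s S p r ∧ St s S r q

/-- The stretches of `p` and `q` meet a common edge of `S`. -/
def Near (s : Bool → Bool → Y → Y) (S : Set Y) (p q : Y) : Prop :=
  ∃ r, (∃ u, ClsSt s S p u ∧ ClsSt s S u r) ∧ Cls s S r q

lemma St.symm (hs : IsCubic s) (h : St s S p q) : St s S q p := by
  obtain ⟨h, hp, hq⟩ := h
  refine ⟨?_, hq, hp⟩
  rcases h with rfl | ⟨b, j, rfl⟩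
  · exact Or.inl rfl
  · exact Or.inr ⟨b, !j, (hs.inv _ _ _).symm⟩

lemma Near.symm (hs : IsCubic s) (h : Near s S p q) : Near s S q p := by
  obtain ⟨t, ⟨u, ⟨x, hpx, hxu⟩, y, huy, hyt⟩, htq⟩ := h
  exact ⟨x, ⟨y, ⟨t, htq.symm hs, hyt.symm hs⟩, u, huy.symm hs, hxu.symm hs⟩, hpx.symm hs⟩

lemma Near.of_cls (hs : IsCubic s) (h : Cls s S p r) (hn : Near s S p q) : Near s S r q := by
  obtain ⟨t, ⟨u, ⟨x, hpx, hxu⟩, y, huy, hyt⟩, htq⟩ := hn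
  exact ⟨t, ⟨u, ⟨x, (h.symm hs).trans hpx, hxu⟩, y, huy, hyt⟩, htq⟩

/-- Edges meeting a common stretch are near each other. -/
lemma near_of_st {x y : Y} (h : St s S p x) (hxy : Cls s S x y) (h' : St s S y q) :
    Near s S p q :=
  ⟨q, ⟨x, ⟨p, .refl p, h⟩, y, hxy, h'⟩, .refl q⟩

lemma exists_cover_clsSt (hs : IsCubic s) (hS : Good s S) (p : Y) :
    ∃ T : Finset Y, T.card ≤ 5 ∧ ∀ q, ClsSt s S p q → ∃ t ∈ T, Cls s S t q := by
  classical
  obtain ⟨I, hI, hmem⟩ := exists_ends hs (hS.fin p)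
  refine ⟨insert p ((I ×ˢ (Finset.univ : Finset Bool)).image fun x => s x.1.2 x.2 x.1.1), ?_, ?_⟩
  · refine (Finset.card_insert_le _ _).trans ?_
    have h1 : ((I ×ˢ (Finset.univ : Finset Bool)).image fun x => s x.1.2 x.2 x.1.1).card ≤ _ :=
      Finset.card_image_le
    rw [Finset.card_product, Finset.card_univ, Fintype.card_bool] at h1
    omega
  · rintro q ⟨r, hr, h | ⟨b, j, rfl⟩, hrS, hq⟩
    · exact ⟨p, Finset.mem_insert_self _ _, h ▸ hr⟩
    · rcases link_or_branch hrS hq with h | h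
      · exact ⟨p, Finset.mem_insert_self _ _, hr.trans (.of_link h)⟩
      · refine ⟨s b j r, Finset.mem_insert_of_mem (Finset.mem_image.2 ⟨((r, b), j), ?_, rfl⟩),
          .refl _⟩
        exact Finset.mem_product.2 ⟨hmem r b hr h, Finset.mem_univ _⟩

lemma exists_cover_near (hs : IsCubic s) (hS : Good s S) (p : Y) :
    ∃ T : Finset Y, T.card ≤ 25 ∧ ∀ q, Near s S p q → ∃ t ∈ T, Cls s S t q := by
  classical
  choose T hT hcov using exists_cover_clsSt hs hS
  refine ⟨(T p).biUnion T, ?_, ?_⟩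
  · calc _ ≤ (T p).card * 5 := Finset.card_biUnion_le_card_mul _ _ _ fun x _ => hT x
      _ ≤ 25 := by have := hT p; omega
  · rintro q ⟨r, ⟨u, hpu, x, hux, hxr⟩, hrq⟩
    obtain ⟨t, ht, htu⟩ := hcov p u hpu
    obtain ⟨t', ht', htr⟩ := hcov t r ⟨x, htu.trans hux, hxr⟩
    exact ⟨t', Finset.mem_biUnion.2 ⟨t, ht, ht'⟩, htr.trans hrq⟩

lemma finite_near (hs : IsCubic s) (hS : Good s S) (p : Y) : {q | Near s S p q}.Finite := by
  obtain ⟨T, -, hT⟩ := exists_cover_near hs hS p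
  refine (T.finite_toSet.biUnion fun t _ => hS.fin t).subset fun q hq => ?_
  obtain ⟨t, ht, h⟩ := hT q hq
  exact Set.mem_biUnion ht h

/-- A set of stretches of `S` that can be removed simultaneously. -/
structure Peel (s : Bool → Bool → Y → Y) (S R : Set Y) : Prop where
  subset : R ⊆ Live s S
  inv : ∀ p ∈ R, ∀ q, Cls s S p q → q ∈ R
  near : ∀ p ∈ R, ∀ q ∈ R, Near s S p q → Cls s S p q
  ends : ∀ p ∈ R, ∀ b, Branch s S p b → ∀ j, ¬ Cls s S p (s b j p)

lemma Peel.step_notMem (hR : Peel s S R) {b : Bool} (hp : p ∈ R)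
    (hb : Branch s S p b) (j : Bool) : s b j p ∉ R := fun h =>
  hR.ends p hp b hb j (hR.near p hp _ h
    (near_of_st ⟨Or.inl rfl, hb.1, hb.1⟩ (.refl p) ⟨Or.inr ⟨b, j, rfl⟩, hb.1, hb.2 j⟩))

/-- A link that arises by removing `R` passes an end of a removed stretch. -/
lemma Link.of_diff {b j : Bool} (h : Link s (S \ R) p b j) :
    Link s S p b j ∨ Branch s S p b ∧ s b (!j) p ∈ R := by
  rcases link_or_branch h.1.1 h.2.1.1 with h' | h'
  · exact Or.inl h'
  · refine Or.inr ⟨h', ?_⟩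
    by_contra hcon
    exact h.2.2 ⟨h'.2 _, hcon⟩

lemma Branch.mono (h : R ⊆ S) {b : Bool} (hb : Branch s R p b) : Branch s S p b :=
  ⟨h hb.1, fun j => h (hb.2 j)⟩

lemma live_diff_subset (hs : IsCubic s) : Live s (S \ R) ⊆ Live s S := by
  rintro p ⟨hp, q, hpq, b, hb⟩
  have hq : q ∈ Live s S := (hb.mono Set.sdiff_subset).live
  have h : Cls s (S \ R) q p := hpq.symm hs
  induction h with
  | refl => exact hq
  | tail _ hl ih =>
    obtain ⟨b', j, hl, rfl⟩ := hl
    have ih := ih hl.1 ((Cls.of_link hl).trans hpq)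
    rcases hl.of_diff with h | ⟨h, -⟩
    · exact Live.of_cls hs ih (.of_link h)
    · exact (h.step hs j).live

lemma Good.diff (hs : IsCubic s) (hS : Good s S) (hR : Peel s S R) : Good s (S \ R) := by
  refine ⟨fun p hp b => ?_, fun p => ?_⟩
  · obtain ⟨j, hj⟩ := hS.deg p hp.1 b
    rcases link_or_branch hp.1 hj with h | h
    · exact ⟨j, hj, fun hjR => hp.2 (hR.inv _ hjR _ ((Cls.of_link h).symm hs))⟩
    · by_contra! hcon
      have h1 : ∀ i, s b i p ∈ R := fun i => by
        by_contra hi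
        exact hcon i ⟨h.2 i, hi⟩
      have h2 := hR.step_notMem (h1 false) (h.step hs false) false
      rw [hs.sq] at h2
      exact h2 (h1 _)
  · by_cases hhit : ∃ z, Cls s (S \ R) p z ∧ ∃ b j, Branch s S z b ∧ s b j z ∈ R
    · obtain ⟨z, hpz, b₀, j₀, hz, hzR⟩ := hhit
      set r₀ := s b₀ j₀ z with hr₀
      have key : ∀ q, Cls s (S \ R) z q →
          ∃ r b j, Cls s S r₀ r ∧ Branch s S r b ∧ Cls s S (s b j r) q := by
        intro q hq
        induction hq with
        | refl =>
          refine ⟨r₀, b₀, !j₀, .refl _, hz.step hs j₀, ?_⟩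
          rw [hr₀, hs.inv]
          exact .refl _
        | @tail q q' _ hl ih =>
          obtain ⟨b', j', hl, rfl⟩ := hl
          obtain ⟨r, b, j, hr, hb, hrq⟩ := ih
          rcases hl.of_diff with h | ⟨h, h'⟩
          · exact ⟨r, b, j, hr, hb, hrq.trans (.of_link h)⟩
          · refine ⟨s b' (!j') q, b', !j', hr.trans (hR.near _ (hR.inv _ hzR _ hr) _ h' ?_),
              h.step hs _, ?_⟩
            · exact near_of_st ⟨Or.inr ⟨b, j, rfl⟩, hb.1, hb.2 j⟩ hrq
                ⟨Or.inr ⟨b', !j', rfl⟩, h.1, h.2 _⟩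
            · rw [hs.sq, Bool.not_not]
              exact .refl _
      refine ((hS.fin r₀).biUnion (t := fun r => ⋃ b, ⋃ j, {q | Cls s S (s b j r) q})
        fun r _ => Set.finite_iUnion fun b => Set.finite_iUnion fun j => hS.fin _).subset
        fun q hq => ?_
      obtain ⟨r, b, j, hr, -, h⟩ := key q ((hpz.symm hs).trans hq)
      exact Set.mem_biUnion hr (Set.mem_iUnion.2 ⟨b, Set.mem_iUnion.2 ⟨j, h⟩⟩)
    · push Not at hhit
      refine (hS.fin p).subset fun q hq => ?_
      change Cls s (S \ R) p q at hq
      change Cls s S p q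
      induction hq with
      | refl => exact .refl p
      | tail hq hl ih =>
        obtain ⟨b, j, hl, rfl⟩ := hl
        rcases hl.of_diff with h | ⟨h, h'⟩
        · exact ih.trans (.of_link h)
        · exact (hhit _ hq b (!j) h h').elim

end Near

section PeelStep

variable {Y : Type*} {s : Bool → Bool → Y → Y} {S R : Set Y} {p q r : Y}

/-- Both ends of the stretch of `p` are at the same vertex. -/
def Loop (s : Bool → Bool → Y → Y) (S : Set Y) (p : Y) : Prop :=
  ∃ q, Cls s S p q ∧ ∃ b j, Branch s S q b ∧ Cls s S p (s b j q)

lemma Loop.of_cls (hs : IsCubic s) (h : Loop s S p) (hpq : Cls s S p q) : Loop s S q := by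
  obtain ⟨x, hx, b, j, hb, hj⟩ := h
  exact ⟨x, (hpq.symm hs).trans hx, b, j, hb, (hpq.symm hs).trans hj⟩

/-- The third edge `t` at the vertex where a looping stretch has its ends. -/
lemma exists_tail (hs : IsCubic s) (hS : Good s S) (h : Loop s S p) :
    ∃ t b, Branch s S t b ∧ (∀ x d, Cls s S p x → Branch s S x d → d = b ∧ ∃ j, x = s b j t) ∧
      ∀ j, Cls s S p (s b j t) := by
  obtain ⟨q, hq, b, j, hb, hj⟩ := h
  refine ⟨s b (!j) q, b, hb.step hs _, fun x d hx hd => ?_, fun i => ?_⟩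
  · have hne : (q, b) ≠ (s b j q, b) := fun h => hs.ne b j q (Prod.mk.inj h).1.symm
    rcases ends_unique hs (hS.fin p) hq hb hj (hb.step hs j) hne hx hd with h | h
    · obtain ⟨rfl, rfl⟩ := Prod.mk.inj h
      exact ⟨rfl, j, (hs.inv_not _ _ _).symm⟩
    · obtain ⟨rfl, rfl⟩ := Prod.mk.inj h
      refine ⟨rfl, !j, ?_⟩
      rw [hs.sq, Bool.not_not]
  · by_cases hi : i = j
    · rwa [hi, hs.inv_not]
    · have : i = !j := by revert hi; cases i <;> cases j <;> simp
      rwa [this, hs.sq, Bool.not_not]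

lemma exists_bool_step (hs : IsCubic s) (b i j : Bool) (p : Y) :
    s b i (s b j p) = p ∨ s b i (s b j p) = s b (!j) p := by
  by_cases hi : i = j
  · exact Or.inr (by rw [hi, hs.sq])
  · have : i = !j := by revert hi; cases i <;> cases j <;> simp
    exact Or.inl (by rw [this, hs.inv])

/-- Every live stretch either is no loop, or stops being live once the third edge at its end
is removed. -/
lemma notMem_live_diff (hs : IsCubic s) {t : Y} {b : Bool}
    (hends : ∀ x d, Cls s S p x → Branch s S x d → d = b ∧ ∃ j, x = s b j t)
    (hcls : ∀ j, Cls s S p (s b j t)) (ht : t ∈ R) :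
    p ∉ Live s (S \ R) := by
  rintro ⟨-, x, hpx, d, hd⟩
  have key : ∀ y, Cls s (S \ R) p y → Cls s S p y := by
    intro y hy
    induction hy with
    | refl => exact .refl p
    | tail _ hl ih =>
      obtain ⟨b', j', hl, rfl⟩ := hl
      rcases hl.of_diff with h | ⟨h, -⟩
      · exact ih.trans (.of_link h)
      · obtain ⟨rfl, i, rfl⟩ := hends _ _ ih h
        rcases exists_bool_step hs b' j' i t with h | h
        · exact absurd ht (h ▸ hl.2.1.2)
        · rw [h]
          exact hcls _
  obtain ⟨rfl, j, rfl⟩ := hends x d (key x hpx) (hd.mono Set.sdiff_subset)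
  have := (hd.2 (!j)).2
  rw [hs.inv] at this
  exact this ht

lemma not_loop_tail (hs : IsCubic s) (hS : Good s S) {t : Y} {b : Bool}
    (htb : Branch s S t b)
    (hends : ∀ x d, Cls s S p x → Branch s S x d → d = b ∧ ∃ j, x = s b j t)
    (hcls : ∀ j, Cls s S p (s b j t)) : ¬ Loop s S t := by
  intro h
  obtain ⟨u, d, -, hends', hcls'⟩ := exists_tail hs hS h
  obtain ⟨rfl, j, hj⟩ := hends' t b (.refl t) htb
  have h1 : s b j t = s b (!j) u := by
    conv_lhs => rw [hj]
    exact hs.sq _ _ _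
  have h2 : Cls s S p t := by
    have h3 := hcls j
    rw [h1] at h3
    exact h3.trans ((hcls' _).symm hs)
  obtain ⟨-, i, hi⟩ := hends t b h2 htb
  exact hs.ne _ _ _ hi.symm

variable [MeasurableSpace Y] [StandardBorelSpace Y]

lemma BRel.near (hm : ∀ b j, Measurable (s b j)) (hS : MeasurableSet S) : BRel s (Near s S) := by
  have h1 : BRel s (St s S) := by
    refine BRel.and (R := fun p q => p ∈ S ∧ q ∈ S) ?_ ?_
    · exact BRel.eq.or (BRel.iUnion fun b => BRel.iUnion fun j => BRel.step hm b j)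
    · exact (measurable_fst hS).inter (measurable_snd hS)
  have h2 : BRel s (ClsSt s S) := (BRel.cls hm hS).comp h1 hm
  exact (h2.comp h2 hm).comp (BRel.cls hm hS) hm

lemma measurableSet_loop (hm : ∀ b j, Measurable (s b j)) (hS : MeasurableSet S) :
    MeasurableSet {p | Loop s S p} := by
  refine (BRel.cls hm hS).exists_meas hm measurable_id
    (R := fun p q => ∃ b j, Branch s S q b ∧ Cls s S p (s b j q)) ?_
  simp only [Set.ofPred_exists]
  refine .iUnion fun b => .iUnion fun j => ?_
  exact (measurable_snd (measurableSet_branch hm hS b)).inter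
    ((BRel.cls hm hS).meas.preimage (measurable_fst.prodMk ((hm b j).comp measurable_snd)))

/-- Removing a suitable Borel set of stretches decreases the measure of the live part by a
definite factor. -/
lemma exists_peel (hs : IsCubic s) (hm : ∀ b j, Measurable (s b j)) (hSm : MeasurableSet S)
    (hS : Good s S) (ν : Measure Y) [IsFiniteMeasure ν] :
    ∃ R, MeasurableSet R ∧ Peel s S R ∧
      ν.real (Live s (S \ R)) ≤ 25 / 26 * ν.real (Live s S) := by
  have hN := BRel.near hm hSm
  have hE := BRel.cls hm hSm
  obtain ⟨col, hcm, hc25, hcE, hcD⟩ := exists_class_coloring hm hE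
    (hN.and (R := fun p q => ¬ Cls s S p q) hE.meas.compl)
    ⟨.refl, fun h => h.symm hs, .trans⟩ (fun p q h => ⟨h.1.symm hs, fun h' => h.2 (h'.symm hs)⟩)
    (fun p p' q h h' => ⟨h'.1.of_cls hs h, fun h'' => h'.2 (h.trans h'')⟩)
    (fun p q h => h.2) hS.fin
    (fun p => (finite_near hs hS p).subset fun q hq => hq.1) 25
    (fun p => by
      obtain ⟨T, hT, h⟩ := exists_cover_near hs hS p
      exact ⟨T, hT, fun q hq => h q hq.1⟩)
  have hL := measurableSet_live hm hSm
  set R : ℕ → Set Y := fun k => {p | p ∈ Live s S ∧ col p = k ∧ ¬ Loop s S p} with hR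
  have hRm : ∀ k, MeasurableSet (R k) := fun k =>
    hL.inter ((hcm (measurableSet_singleton k)).inter (measurableSet_loop hm hSm).compl)
  have hpeel : ∀ k, Peel s S (R k) := by
    intro k
    refine ⟨fun p hp => hp.1, fun p hp q hpq => ⟨?_, ?_, ?_⟩, fun p hp q hq h => ?_,
      fun p hp b hb j h => ?_⟩
    · exact Live.of_cls hs hp.1 hpq
    · rw [← hp.2.1]; exact (hcE p q hpq).symm
    · exact fun h => hp.2.2 (h.of_cls hs (hpq.symm hs))
    · by_contra hcon
      exact hcD p q ⟨h, hcon⟩ (hp.2.1.trans hq.2.1.symm)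
    · exact hp.2.2 ⟨p, .refl p, b, j, hb, h⟩
  have hcover : Live s S ⊆ ⋃ k ∈ Finset.range 26, Live s S \ Live s (S \ R k) := by
    intro p hp
    have : ∃ k < 26, p ∉ Live s (S \ R k) := by
      by_cases h : Loop s S p
      · obtain ⟨t, b, htb, hends, hcls⟩ := exists_tail hs hS h
        exact ⟨col t, Nat.lt_succ_of_le (hc25 t), notMem_live_diff hs hends hcls
          ⟨htb.live, rfl, not_loop_tail hs hS htb hends hcls⟩⟩
      · exact ⟨col p, Nat.lt_succ_of_le (hc25 p), fun h' => h'.1.2 ⟨hp, rfl, h⟩⟩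
    obtain ⟨k, hk, hpk⟩ := this
    exact Set.mem_biUnion (Finset.mem_range.2 hk) ⟨hp, hpk⟩
  have hsum : ν.real (Live s S) ≤ ∑ k ∈ Finset.range 26, ν.real (Live s S \ Live s (S \ R k)) :=
    (measureReal_mono hcover (measure_ne_top _ _)).trans (measureReal_biUnion_finset_le _ _)
  obtain ⟨k, -, hk⟩ := Finset.exists_le_of_sum_le (s := Finset.range 26)
    (f := fun _ => ν.real (Live s S) / 26) ⟨0, by simp⟩ (le_trans (by simp; linarith) hsum)
  refine ⟨R k, hRm k, hpeel k, ?_⟩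
  rw [measureReal_sdiff (live_diff_subset hs) (measurableSet_live hm (hSm.diff (hRm k)))] at hk
  linarith

end PeelStep

section Limit

variable {Y : Type*} {s : Bool → Bool → Y → Y} {S R : Set Y} {p q r : Y}

lemma good_univ : Good s (Set.univ : Set Y) := by
  refine ⟨fun p _ b => ⟨true, trivial⟩, fun p => (Set.finite_singleton p).subset fun q hq => ?_⟩
  change Cls s Set.univ p q at hq
  induction hq with
  | refl => rfl
  | tail _ hl _ =>
    obtain ⟨b, j, hl, -⟩ := hl
    exact (hl.2.2 trivial).elim

/-- In a decreasing sequence, a stretch closing up to a cycle persists once an edge of it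
does. -/
lemma cls_iInter_iff {S : ℕ → Set Y} (hS : ∀ n, Good s (S n)) (hanti : Antitone S)
    {n : ℕ} (hp : p ∈ ⋂ n, S n) (hn : p ∉ Live s (S n)) :
    (∀ q, Cls s (⋂ n, S n) p q ↔ Cls s (S n) p q) ∧ ∀ q, Cls s (⋂ n, S n) p q → ∀ b,
      (∃ j, s b j q ∈ ⋂ n, S n) ∧ ¬ Branch s (⋂ n, S n) q b := by
  have hsub : ⋂ n, S n ⊆ S n := Set.iInter_subset _ _
  have hbr : ∀ q, Cls s (S n) p q → ∀ b, ¬ Branch s (S n) q b := fun q hq b hb =>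
    hn ⟨hsub hp, q, hq, b, hb⟩
  have hnext : ∀ q, Cls s (S n) p q → q ∈ ⋂ n, S n → ∀ b j, Link s (S n) q b j →
      s b j q ∈ ⋂ n, S n := by
    intro q hq hqS b j hl
    refine Set.mem_iInter.2 fun m => ?_
    obtain ⟨i, hi⟩ := (hS (max m n)).deg q (Set.mem_iInter.1 hqS _) b
    by_cases hij : i = j
    · exact hanti (le_max_left m n) (hij ▸ hi)
    · have : i = !j := by revert hij; cases i <;> cases j <;> simp
      exact (hl.2.2 (this ▸ hanti (le_max_right m n) hi)).elim
  have h1 : ∀ q, Cls s (⋂ n, S n) p q → Cls s (S n) p q := by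
    intro q hq
    induction hq with
    | refl => exact .refl p
    | tail _ hl ih =>
      obtain ⟨b, j, hl, rfl⟩ := hl
      exact ih.trans (.of_link
        ((link_or_branch (hsub hl.1) (hsub hl.2.1)).resolve_right (hbr _ ih b)))
  have h2 : ∀ q, Cls s (S n) p q → Cls s (⋂ n, S n) p q := by
    intro q hq
    induction hq with
    | refl => exact .refl p
    | tail hq hl ih =>
      obtain ⟨b, j, hl, rfl⟩ := hl
      have hqS := ih.mem hp
      exact ih.trans (.of_link ⟨hqS, hnext _ hq hqS b j hl, fun h => hl.2.2 (hsub h)⟩)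
  refine ⟨fun q => ⟨h1 q, h2 q⟩, fun q hq b => ⟨?_, fun h => hbr q (h1 q hq) b (h.mono hsub)⟩⟩
  obtain ⟨j, hj⟩ := (hS n).deg q (hsub (hq.mem hp)) b
  exact ⟨j, hnext q (h1 q hq) (hq.mem hp) b j
    ((link_or_branch (hsub (hq.mem hp)) hj).resolve_right (hbr q (h1 q hq) b))⟩

variable [MeasurableSpace Y] [StandardBorelSpace Y]

/-- The partial colorings occurring in the construction: all edges off `S` are colored. -/
structure Partial (s : Bool → Bool → Y → Y) (S : Set Y) (c : Y → Fin 4) : Prop where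
  meas : MeasurableSet S
  good : Good s S
  measc : Measurable c
  proper : ∀ p b j, p ∉ S → s b j p ∉ S → c p ≠ c (s b j p)

lemma Partial.exists_next (hs : IsCubic s) (hm : ∀ b j, Measurable (s b j)) (ν : Measure Y)
    [IsFiniteMeasure ν] {c : Y → Fin 4} (h : Partial s S c) :
    ∃ S' c', Partial s S' c' ∧ S' ⊆ S ∧ (∀ p ∉ S, c' p = c p) ∧
      ν.real (Live s S') ≤ 25 / 26 * ν.real (Live s S) := by
  obtain ⟨R, hRm, hR, hν⟩ := exists_peel hs hm h.meas h.good ν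
  have hRS : R ⊆ S := hR.subset.trans Live.subset
  obtain ⟨c', hc', hcc, hprop⟩ := exists_extension hs hm h.meas hRm hRS hR.inv
    (fun p _ => h.good.fin p)
    (fun p hp b j hq => hR.near p hp _ hq
      (near_of_st ⟨Or.inl rfl, hRS hp, hRS hp⟩ (.refl p) ⟨Or.inr ⟨b, j, rfl⟩, hRS hp, hRS hq⟩))
    h.measc h.proper (fun p hp => by
      obtain ⟨-, q, hq, b, hb⟩ := hR.subset hp
      exact exists_stretch_coloring hs (h.good.fin p) hq hb
        (fun j hj => hR.ends q (hR.inv p hp q hq) b hb j ((hq.symm hs).trans hj)) c)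
  have hor : ∀ p, p ∉ S \ R → p ∉ S ∨ p ∈ R := fun p hp => by
    by_contra! hcon
    exact hp hcon
  exact ⟨S \ R, c', ⟨h.meas.diff hRm, h.good.diff hs hR, hc', fun p b j hp hq =>
    hprop p b j (hor _ hp) (hor _ hq)⟩, Set.sdiff_subset,
      fun p hp => hcc p fun h' => hp (hRS h'), hν⟩

/-- The edges of a Borel bipartite cubic graph can be colored with four colors in a Borel way,
up to a null set of edges. -/
theorem exists_ae_coloring (hs : IsCubic s) (hm : ∀ b j, Measurable (s b j)) (ν : Measure Y)
    [IsFiniteMeasure ν] :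
    ∃ N : Set Y, MeasurableSet N ∧ ν N = 0 ∧ ∃ c : Y → Fin 4, Measurable c ∧
      ∀ p b j, p ∉ N → s b j p ∉ N → c p ≠ c (s b j p) := by
  classical
  have hstep : ∀ x : {x : Set Y × (Y → Fin 4) // Partial s x.1 x.2},
      ∃ y : {x : Set Y × (Y → Fin 4) // Partial s x.1 x.2}, y.1.1 ⊆ x.1.1 ∧
        (∀ p ∉ x.1.1, y.1.2 p = x.1.2 p) ∧
        ν.real (Live s y.1.1) ≤ 25 / 26 * ν.real (Live s x.1.1) := fun x => by
    obtain ⟨S', c', h, h'⟩ := x.2.exists_next hs hm ν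
    exact ⟨⟨(S', c'), h⟩, h'⟩
  choose next hnext using hstep
  let x : ℕ → {x : Set Y × (Y → Fin 4) // Partial s x.1 x.2} := fun n => next^[n]
    ⟨(Set.univ, fun _ => 0), .univ, good_univ, measurable_const, fun p b j hp => (hp trivial).elim⟩
  have hx : ∀ n, x (n + 1) = next (x n) := fun n => Function.iterate_succ_apply' _ _ _
  set S : ℕ → Set Y := fun n => (x n).1.1 with hSdef
  set c : ℕ → Y → Fin 4 := fun n => (x n).1.2 with hcdef
  have hP : ∀ n, Partial s (S n) (c n) := fun n => (x n).2
  have hanti : Antitone S := antitone_nat_of_succ_le fun n => by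
    simp only [hSdef, hx]; exact (hnext _).1
  have hc1 : ∀ n, ∀ p ∉ S n, c (n + 1) p = c n p := fun n => by
    simp only [hcdef, hx]; exact (hnext _).2.1
  have hν1 : ∀ n, ν.real (Live s (S (n + 1))) ≤ 25 / 26 * ν.real (Live s (S n)) := fun n => by
    simp only [hSdef, hx]; exact (hnext _).2.2
  have hν : ∀ n, ν.real (Live s (S n)) ≤ (25 / 26) ^ n * ν.real (Live s (S 0)) := by
    intro n
    induction n with
    | zero => simp
    | succ n ih => rw [pow_succ']; linarith [hν1 n]
  have hLm : ∀ n, MeasurableSet (Live s (S n)) := fun n => measurableSet_live hm (hP n).meas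
  have hSm : MeasurableSet (⋂ n, S n) := .iInter fun n => (hP n).meas
  have hconst : ∀ n p, p ∉ S n → ∀ m, n ≤ m → c m p = c n p := by
    intro n p hp m hnm
    induction m, hnm using Nat.le_induction with
    | base => rfl
    | succ m hnm ih => rw [hc1 m p fun h => hp (hanti hnm h), ih]
  have hex : ∀ p, ∃ n, p ∉ S n ∨ p ∈ ⋂ n, S n := by
    intro p
    by_cases h : p ∈ ⋂ n, S n
    · exact ⟨0, Or.inr h⟩
    · obtain ⟨n, hn⟩ := not_forall.1 fun h' => h (Set.mem_iInter.2 h')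
      exact ⟨n, Or.inl hn⟩
  set τ : Y → ℕ := fun p => Nat.find (hex p) with hτ
  have hτm : Measurable τ := measurable_find hex fun n => (hP n).meas.compl.union hSm
  have hτS : ∀ p ∉ ⋂ n, S n, p ∉ S (τ p) := fun p hp => (Nat.find_spec (hex p)).resolve_right hp
  have hcτ : Measurable fun p => c (τ p) p :=
    (measurable_from_prod_countable_right (f := fun z : ℕ × Y => c z.1 z.2)
      fun n => (hP n).measc).comp (hτm.prodMk measurable_id)
  set T : Set Y := (⋂ n, S n) ∩ ⋃ n, (Live s (S n))ᶜ with hT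
  have hTn : ∀ p ∈ T, ∃ n, p ∉ Live s (S n) := fun p hp => Set.mem_iUnion.1 hp.2
  have hcl : ∀ p ∈ T, ∀ n, p ∉ Live s (S n) → _ := fun p hp n hn =>
    cls_iInter_iff (fun n => (hP n).good) hanti hp.1 hn
  have hfin : ∀ p ∈ T, {q | Cls s (⋂ n, S n) p q}.Finite := by
    intro p hp
    obtain ⟨n, hn⟩ := hTn p hp
    exact ((hP n).good.fin p).subset fun q hq => ((hcl p hp n hn).1 q).1 hq
  obtain ⟨c', hc', -, hprop⟩ := exists_extension hs hm (T := T) hSm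
    (hSm.inter (.iUnion fun n => (hLm n).compl)) Set.inter_subset_left
    (fun p hp q hq => by
      obtain ⟨n, hn⟩ := hTn p hp
      refine ⟨hq.mem hp.1, Set.mem_iUnion.2 ⟨n, fun h => hn ?_⟩⟩
      exact Live.of_cls hs h ((((hcl p hp n hn).1 q).1 hq).symm hs))
    hfin
    (fun p hp b j hq => by
      obtain ⟨n, hn⟩ := hTn p hp
      exact .of_link ((link_or_branch hp.1 hq.1).resolve_right
        ((hcl p hp n hn).2 p (.refl p) b).2))
    hcτ
    (fun p b j hp hq => by
      have h1 := hτS _ hp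
      have h2 := hτS _ hq
      rw [← hconst _ _ h1 _ (le_max_left _ (τ (s b j p))), ← hconst _ _ h2 _ (le_max_right (τ p) _)]
      exact (hP _).proper p b j (fun h => h1 (hanti (le_max_left _ _) h))
        (fun h => h2 (hanti (le_max_right _ _) h)))
    (fun p hp => by
      obtain ⟨n, hn⟩ := hTn p hp
      exact exists_closed_stretch_coloring hs hp.1 (hfin p hp) (hcl p hp n hn).2
        fun p => c (τ p) p)
  refine ⟨⋂ n, Live s (S n), .iInter hLm, ?_, c', hc', fun p b j hp hq => hprop p b j ?_ ?_⟩
  · have h0 : ν.real (⋂ n, Live s (S n)) ≤ 0 := by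
      have hlim : Filter.Tendsto (fun n : ℕ => (25 / 26 : ℝ) ^ n * ν.real (Live s (S 0)))
          Filter.atTop (nhds (0 * ν.real (Live s (S 0)))) :=
        (tendsto_pow_atTop_nhds_zero_of_lt_one (by norm_num) (by norm_num)).mul_const _
      rw [zero_mul] at hlim
      exact ge_of_tendsto' hlim fun n =>
        (measureReal_mono (Set.iInter_subset _ n)).trans (hν n)
    exact (measureReal_eq_zero_iff).1 (le_antisymm h0 measureReal_nonneg)
  all_goals
    by_contra! hcon
    obtain ⟨h1, h2⟩ := hcon
    simp only [Set.mem_iInter, not_forall] at hp hq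
    simp only [hT, Set.mem_inter_iff, Set.mem_iUnion, Set.mem_compl_iff, not_and, not_exists,
      not_not] at h2
  · obtain ⟨n, hn⟩ := hp
    exact hn (h2 h1 n)
  · obtain ⟨n, hn⟩ := hq
    exact hn (h2 h1 n)

end Limit

section Transfer

variable {X : Type*} {G : SimpleGraph X}

/-- The neighbors in a 3-regular graph are enumerated increasingly with respect to `f` in a unique
way. -/
lemma existsUnique_enum (hreg : ∀ x, (G.neighborSet x).encard = 3) {f : X → ℝ}
    (hf : Function.Injective f) (x : X) :
    ∃ y : Fin 3 → X, StrictMono (f ∘ y) ∧ (∀ z, G.Adj x z ↔ ∃ i, z = y i) ∧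
      ∀ y' : Fin 3 → X, StrictMono (f ∘ y') → (∀ i, G.Adj x (y' i)) → y' = y := by
  classical
  have hfin : (G.neighborSet x).Finite := Set.finite_of_encard_eq_coe (hreg x)
  set F : Finset ℝ := hfin.toFinset.image f with hF
  have hmem : ∀ z, f z ∈ F ↔ G.Adj x z := fun z => by simp [hF, hf.eq_iff]
  have hcard : F.card = 3 := by
    rw [hF, Finset.card_image_of_injective _ hf]
    have h1 := hreg x
    rw [hfin.encard_eq_coe_toFinset_card] at h1
    exact_mod_cast h1
  have hex : ∀ i : Fin 3, ∃ z, f z = F.orderEmbOfFin hcard i := fun i => by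
    obtain ⟨z, -, hz⟩ := Finset.mem_image.1 (Finset.orderEmbOfFin_mem F hcard i)
    exact ⟨z, hz⟩
  choose y hy using hex
  have hfy : f ∘ y = F.orderEmbOfFin hcard := funext hy
  refine ⟨y, hfy ▸ (F.orderEmbOfFin hcard).strictMono, fun z => ?_, fun y' h1 h2 => ?_⟩
  · rw [← hmem, ← Finset.mem_coe, ← Finset.range_orderEmbOfFin F hcard, ← hfy]
    constructor
    · rintro ⟨i, hi⟩
      exact ⟨i, (hf hi).symm⟩
    · rintro ⟨i, rfl⟩
      exact ⟨i, rfl⟩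
  · have := Finset.orderEmbOfFin_unique hcard (fun i => (hmem _).2 (h2 i)) h1
    rw [← hfy] at this
    exact funext fun i => hf (congrFun this i)

variable [MeasurableSpace X] [StandardBorelSpace X]

/-- The neighbors in a 3-regular Borel graph can be enumerated in a Borel way. -/
lemma exists_measurable_enum (hG : MeasurableSet {p : X × X | G.Adj p.1 p.2})
    (hreg : ∀ x, (G.neighborSet x).encard = 3) :
    ∃ g : Fin 3 → X → X, (∀ i, Measurable (g i)) ∧ (∀ x, Function.Injective fun i => g i x) ∧
      ∀ x z, G.Adj x z ↔ ∃ i, z = g i x := by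
  obtain ⟨f, hf⟩ := exists_measurableEmbedding_real X
  set Z : Set (X × (Fin 3 → X)) := {z | StrictMono (f ∘ z.2) ∧ ∀ i, G.Adj z.1 (z.2 i)} with hZ
  have hm : ∀ i, Measurable fun z : X × (Fin 3 → X) => z.2 i := fun i =>
    (measurable_pi_apply i).comp measurable_snd
  have hZm : MeasurableSet Z := by
    have : Z = (⋂ i, ⋂ j, ⋂ (_ : i < j), {z | f (z.2 i) < f (z.2 j)}) ∩
        ⋂ i, {z | G.Adj z.1 (z.2 i)} := by
      ext z
      simp only [hZ, Set.mem_ofPred_eq, Set.mem_inter_iff, Set.mem_iInter]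
      exact Iff.rfl
    rw [this]
    exact .inter (.iInter fun i => .iInter fun j => .iInter fun _ =>
      measurableSet_lt (hf.measurable.comp (hm i)) (hf.measurable.comp (hm j)))
      (.iInter fun i => hG.preimage (measurable_fst.prodMk (hm i)))
  have : StandardBorelSpace Z := hZm.standardBorel
  have hinj : Function.Injective fun z : Z => z.1.1 := by
    rintro ⟨⟨x, y⟩, h1, h2⟩ ⟨⟨x', y'⟩, h1', h2'⟩ (rfl : x = x')
    obtain ⟨w, -, -, hw⟩ := existsUnique_enum hreg hf.injective x
    have h3 : y = w := hw y h1 h2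
    have h4 : y' = w := hw y' h1' h2'
    rw [Subtype.mk.injEq, h3, h4]
  have hemb : MeasurableEmbedding fun z : Z => z.1.1 :=
    (measurable_fst.comp measurable_subtype_coe).measurableEmbedding hinj
  obtain ⟨g, hg, hge⟩ := hemb.exists_measurable_extend (g := fun z : Z => z.1.2)
    (measurable_snd.comp measurable_subtype_coe) fun x => ⟨fun _ => x⟩
  have hgx : ∀ x, Function.Injective (g x) ∧ ∀ z, G.Adj x z ↔ ∃ i, z = g x i := by
    intro x
    obtain ⟨y, hy, hadj, -⟩ := existsUnique_enum hreg hf.injective x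
    have h1 : g x = y := congrFun hge ⟨(x, y), hy, fun i => (hadj _).2 ⟨i, rfl⟩⟩
    rw [h1]
    exact ⟨hy.injective.of_comp, hadj⟩
  exact ⟨fun i x => g x i, fun i => (measurable_pi_apply i).comp hg, fun x => (hgx x).1,
    fun x => (hgx x).2⟩

/-- Borel cyclic permutations of the neighbors of a vertex. -/
lemma exists_turn {g : Fin 3 → X → X} (hgm : ∀ i, Measurable (g i))
    (hinj : ∀ x, Function.Injective fun i => g i x) (hadj : ∀ x z, G.Adj x z ↔ ∃ i, z = g i x) :
    ∃ t : Bool → X × X → X, (∀ j, Measurable (t j)) ∧ ∀ x y, G.Adj x y →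
      (∀ j, G.Adj x (t j (x, y)) ∧ t j (x, y) ≠ y ∧ t (!j) (x, t j (x, y)) = y ∧
        t j (x, t j (x, y)) = t (!j) (x, y)) ∧
      ∀ z, G.Adj x z → z ≠ y → ∃ j, z = t j (x, y) := by
  classical
  have hgm' : ∀ i, Measurable fun z : X × X => g i z.1 := fun i => (hgm i).comp measurable_fst
  have hset : ∀ i, MeasurableSet {z : X × X | z.2 = g i z.1} := fun i =>
    measurableSet_eq_fun measurable_snd (hgm' i)
  let t : Bool → X × X → X := fun j z =>
    if z.2 = g 0 z.1 then g (bif j then 2 else 1) z.1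
    else if z.2 = g 1 z.1 then g (bif j then 0 else 2) z.1 else g (bif j then 1 else 0) z.1
  have ht : ∀ j x i, t j (x, g i x) = g (i + bif j then 2 else 1) x := by
    intro j x i
    have h := fun i j => (hinj x).eq_iff (a := i) (b := j)
    beta_reduce at h
    simp only [t, h]
    fin_cases i <;> cases j <;> simp
  have h1 : ∀ (i : Fin 3) (j : Bool), (i + bif j then 2 else 1) ≠ i := by decide
  have h2 : ∀ (i : Fin 3) (j : Bool), ((i + bif j then 2 else 1) + bif !j then 2 else 1) = i := by
    decide
  have h3 : ∀ (i : Fin 3) (j : Bool), ((i + bif j then 2 else 1) + bif j then 2 else 1) =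
      i + bif !j then 2 else 1 := by decide
  have h4 : ∀ i k : Fin 3, k ≠ i → ∃ j : Bool, k = i + bif j then 2 else 1 := by decide
  refine ⟨t, fun j => (hgm' _).ite (hset 0) ((hgm' _).ite (hset 1) (hgm' _)), fun x y hxy => ?_⟩
  obtain ⟨i, rfl⟩ := (hadj x y).1 hxy
  refine ⟨fun j => ⟨?_, ?_, ?_, ?_⟩, fun z hz hne => ?_⟩
  · rw [ht]; exact (hadj _ _).2 ⟨_, rfl⟩
  · rw [ht, (hinj x).ne_iff]
    exact h1 i j
  · rw [ht, ht, h2]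
  · rw [ht, ht, ht, h3]
  · obtain ⟨k, rfl⟩ := (hadj x z).1 hz
    simp only [ht]
    have hk : k ≠ i := fun h => hne (h ▸ rfl)
    obtain ⟨j, hj⟩ := h4 i k hk
    exact ⟨j, by rw [← hj]⟩

end Transfer

section Final

variable {X : Type*} {G : SimpleGraph X} {A : Set X}

/-- The edges of a bipartite graph, directed away from the part `A`. -/
abbrev EdgeSpace (G : SimpleGraph X) (A : Set X) : Type _ :=
  {p : X × X // p.1 ∈ A ∧ G.Adj p.1 p.2}

/-- An edge of a bipartite graph given by two adjacent vertices. -/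
noncomputable def mkEdge (hbip : ∀ x y, G.Adj x y → (x ∈ A ↔ y ∉ A)) (x y : X)
    (h : G.Adj x y) : EdgeSpace G A :=
  open Classical in
  if hx : x ∈ A then ⟨(x, y), hx, h⟩
  else ⟨(y, x), by_contra fun hy => hx ((hbip x y h).2 hy), h.symm⟩

lemma mkEdge_symm (hbip : ∀ x y, G.Adj x y → (x ∈ A ↔ y ∉ A)) {x y : X} (h : G.Adj x y) :
    mkEdge hbip x y h = mkEdge hbip y x h.symm := by
  unfold mkEdge
  have := hbip x y h
  by_cases hx : x ∈ A
  · rw [dif_pos hx, dif_neg (this.1 hx)]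
  · rw [dif_neg hx, dif_pos (by_contra fun hy => hx (this.2 hy))]

/-- The step maps on the edges of a bipartite graph induced by permutations of the neighbors of
all vertices. -/
def edgeStep (hbip : ∀ x y, G.Adj x y → (x ∈ A ↔ y ∉ A)) (t : Bool → X × X → X)
    (ht : ∀ x y, G.Adj x y → ∀ j, G.Adj x (t j (x, y))) (b j : Bool) (p : EdgeSpace G A) :
    EdgeSpace G A :=
  match b with
  | true => ⟨(p.1.1, t j (p.1.1, p.1.2)), p.2.1, ht _ _ p.2.2 j⟩
  | false => ⟨(t j (p.1.2, p.1.1), p.1.2),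
      by_contra fun h => ((hbip _ _ p.2.2).1 p.2.1) ((hbip _ _ (ht _ _ p.2.2.symm j)).2 h),
      (ht _ _ p.2.2.symm j).symm⟩

end Final

end CubicEdge

open CubicEdge

/-- Suppose `G` is a `3`-regular Borel bipartite graph on a standard Borel space `X` and
`μ` is a Borel probability measure on `X`. Then `G` has a Borel edge coloring with `4`
colors modulo a `μ`-null set: there is a Borel `μ`-conull set `X'` that is a union of
connected components of `G` such that the restriction of `G` to `X'` admits a Borel edge
coloring with `4` colors (given as a Borel function on ordered pairs, symmetric on edges,
assigning different colors to distinct intersecting edges within `X'`). -/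
theorem stmt_19 (X : Type) [MeasurableSpace X] [StandardBorelSpace X]
    (G : SimpleGraph X)
    (hGBorel : MeasurableSet {p : X × X | G.Adj p.1 p.2})
    (hGreg : ∀ x, (G.neighborSet x).encard = 3)
    (hGbip : ∃ A : Set X, MeasurableSet A ∧ ∀ x y, G.Adj x y → (x ∈ A ↔ y ∉ A))
    (μ : Measure X) [IsProbabilityMeasure μ] :
    ∃ X' : Set X, MeasurableSet X' ∧ μ X'ᶜ = 0 ∧
      (∀ x ∈ X', ∀ y, G.Reachable x y → y ∈ X') ∧
      ∃ c : X × X → Fin 4, Measurable c ∧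
        (∀ x ∈ X', ∀ y, G.Adj x y → c (x, y) = c (y, x)) ∧
        (∀ x ∈ X', ∀ y z, G.Adj x y → G.Adj x z → y ≠ z → c (x, y) ≠ c (x, z)) := by
  classical
  obtain ⟨A, hA, hbip⟩ := hGbip
  obtain ⟨g, hgm, hinj, hadj⟩ := exists_measurable_enum hGBorel hGreg
  obtain ⟨t, htm, ht⟩ := exists_turn hgm hinj hadj
  have htadj : ∀ x y, G.Adj x y → ∀ j, G.Adj x (t j (x, y)) := fun x y h j => ((ht x y h).1 j).1
  have hgadj : ∀ i x, G.Adj x (g i x) := fun i x => (hadj _ _).2 ⟨i, rfl⟩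
  have hYm : MeasurableSet {p : X × X | p.1 ∈ A ∧ G.Adj p.1 p.2} :=
    (measurable_fst hA).inter hGBorel
  have : StandardBorelSpace (EdgeSpace G A) := hYm.standardBorel
  set s := edgeStep hbip t htadj with hsdef
  have hs : IsCubic s := by
    refine ⟨?_, ?_, ?_, ?_⟩
    · rintro (_ | _) j ⟨⟨x, y⟩, hx, h⟩
      · exact Subtype.ext (Prod.ext ((ht y x h.symm).1 j).2.2.1 rfl)
      · exact Subtype.ext (Prod.ext rfl ((ht x y h).1 j).2.2.1)
    · rintro (_ | _) j ⟨⟨x, y⟩, hx, h⟩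
      · exact Subtype.ext (Prod.ext ((ht y x h.symm).1 j).2.2.2 rfl)
      · exact Subtype.ext (Prod.ext rfl ((ht x y h).1 j).2.2.2)
    · rintro (_ | _) j ⟨⟨x, y⟩, hx, h⟩ he
      · exact ((ht y x h.symm).1 j).2.1 (congrArg (fun p => p.1.1) he)
      · exact ((ht x y h).1 j).2.1 (congrArg (fun p => p.1.2) he)
    · rintro (_ | _) j j' ⟨⟨x, y⟩, hx, h⟩ he
      · exact ((ht y x h.symm).1 j).2.1 (congrArg (fun p => p.1.1) he)
      · exact ((ht x y h).1 j).2.1 (congrArg (fun p => p.1.2) he)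
  have hm : ∀ b j, Measurable (s b j) := by
    have h1 : Measurable fun p : EdgeSpace G A => p.1.1 :=
      measurable_fst.comp measurable_subtype_coe
    have h2 : Measurable fun p : EdgeSpace G A => p.1.2 :=
      measurable_snd.comp measurable_subtype_coe
    rintro (_ | _) j
    · exact (((htm j).comp (h2.prodMk h1)).prodMk h2).subtype_mk
    · exact (h1.prodMk ((htm j).comp (h1.prodMk h2))).subtype_mk
  let u : List (Fin 3) → X → X := fun w x => w.foldl (fun y i => g i y) x
  have hum : ∀ w, Measurable (u w) := by
    intro w
    induction w with
    | nil => exact measurable_id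
    | cons i w ih => exact ih.comp (hgm i)
  let e : Fin 3 → X → EdgeSpace G A := fun i x => mkEdge hbip x (g i x) (hgadj i x)
  have hem : ∀ i, Measurable (e i) := by
    intro i
    have : MeasurableEmbedding (Subtype.val : EdgeSpace G A → X × X) := .subtype_coe hYm
    rw [← this.measurable_comp_iff]
    have : Subtype.val ∘ e i = fun x => if x ∈ A then (x, g i x) else (g i x, x) := by
      funext x
      simp only [e, mkEdge, Function.comp]
      split_ifs <;> rfl
    rw [this]
    exact (measurable_id.prodMk (hgm i)).ite hA ((hgm i).prodMk measurable_id)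
  let ν₀ : Measure (EdgeSpace G A) :=
    Measure.sum fun z : List (Fin 3) × Fin 3 => μ.map (e z.2 ∘ u z.1)
  obtain ⟨N, hN, hN0, c, hc, hcN⟩ := exists_ae_coloring hs hm ν₀.toFinite
  have hν₀ : ∀ w i, μ {x | e i (u w x) ∈ N} = 0 := by
    intro w i
    have h1 : ν₀ N = 0 := absolutelyContinuous_toFinite ν₀ hN0
    have h2 := (Measure.sum_apply_eq_zero' hN).1 h1 (w, i)
    rwa [Measure.map_apply ((hem i).comp (hum w)) hN] at h2
  set X' : Set X := {x | ∀ w i, e i (u w x) ∉ N} with hX'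
  have hX'N : ∀ x ∈ X', ∀ y (h : G.Adj x y), mkEdge hbip x y h ∉ N := by
    intro x hx y h
    obtain ⟨i, rfl⟩ := (hadj x y).1 h
    exact hx [] i
  have hX'eq : X'ᶜ = ⋃ w, ⋃ i, {x | e i (u w x) ∈ N} := by
    ext x
    simp [hX']
  obtain ⟨c₀, hc₀, hcc₀⟩ := (MeasurableEmbedding.subtype_coe hYm).exists_measurable_extend hc
    fun _ => ⟨0⟩
  have hc₀' : ∀ x y (hx : x ∈ A) (h : G.Adj x y), c₀ (x, y) = c ⟨(x, y), hx, h⟩ :=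
    fun x y hx h => congrFun hcc₀ ⟨(x, y), hx, h⟩
  have hcol : ∀ x y (h : G.Adj x y),
      (if x ∈ A then c₀ (x, y) else c₀ (y, x)) = c (mkEdge hbip x y h) := by
    intro x y h
    unfold mkEdge
    split_ifs with hx
    · exact hc₀' x y hx h
    · exact hc₀' y x (by_contra fun hy => hx ((hbip x y h).2 hy)) h.symm
  refine ⟨X', ?_, ?_, ?_, fun z => if z.1 ∈ A then c₀ (z.1, z.2) else c₀ (z.2, z.1), ?_, ?_, ?_⟩
  · rw [← MeasurableSet.compl_iff, hX'eq]
    exact .iUnion fun w => .iUnion fun i => ((hem i).comp (hum w)) hN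
  · rw [hX'eq]
    exact measure_iUnion_null fun w => measure_iUnion_null fun i => hν₀ w i
  · rintro x hx y ⟨w⟩
    induction w with
    | nil => exact hx
    | cons h _ ih =>
      obtain ⟨i, rfl⟩ := (hadj _ _).1 h
      exact ih fun w => hx (i :: w)
  · exact (hc₀.comp (measurable_fst.prodMk measurable_snd)).ite (measurable_fst hA)
      (hc₀.comp (measurable_snd.prodMk measurable_fst))
  · intro x _ y h
    beta_reduce
    rw [hcol x y h, hcol y x h.symm, mkEdge_symm]
  · intro x hx y z hy hz hne
    beta_reduce
    rw [hcol x y hy, hcol x z hz]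
    obtain ⟨j, rfl⟩ := (ht x y hy).2 z hz hne.symm
    have : ∃ b, mkEdge hbip x (t j (x, y)) hz = s b j (mkEdge hbip x y hy) := by
      unfold mkEdge
      split_ifs
      · exact ⟨true, rfl⟩
      · exact ⟨false, rfl⟩
    obtain ⟨b, hb⟩ := this
    have h2 := hX'N x hx _ hz
    rw [hb] at h2 ⊢
    exact hcN _ b j (hX'N x hx y hy) h2
end
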